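/- arXiv:math/0112129 — 7 statements merged into one kernel-verified Lean document; each statement's English description precedes it below -/
import Mathlib

section
/- Let S be a quasi-Frobenius ring and let 0 → U → V → W → 0 be a short exact sequence of left S-modules. If two of the three modules U, V, W are stably finitely generated, then so is the third. -/
universe u

/-- A left `S`-module `M` is *stably finitely generated* if there are a finitely generated
`S`-module `N` and projective `S`-modules `P`, `Q` with `M ⊕ P ≅ N ⊕ Q`. -/
def StablyFG (S : Type u) [Ring S] (M : Type u) [AddCommGroup M] [Module S M] : Prop :=
  ∃ (N P Q : Type u) (_ : AddCommGroup N) (_ : AddCommGroup P) (_ : AddCommGroup Q)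
    (_ : Module S N) (_ : Module S P) (_ : Module S Q),
    Module.Finite S N ∧ Module.Projective S P ∧ Module.Projective S Q ∧
      Nonempty ((M × P) ≃ₗ[S] (N × Q))

def QFR (S : Type u) [Ring S] : Prop :=
  ∀ (M : Type u) [AddCommGroup M] [Module S M], Module.Projective S M ↔ Module.Injective S M

theorem exists_inj_embed (S : Type u) [Ring S] (M : Type u) [AddCommGroup M] [Module S M] :
    ∃ (E : Type u) (_ : AddCommGroup E) (_ : Module S E) (e : M →ₗ[S] E),
      Module.Injective S E ∧ Function.Injective e := by
  obtain ⟨⟨I, hI, f, hf⟩⟩ := CategoryTheory.EnoughInjectives.presentation (ModuleCat.of S M)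
  refine ⟨I, inferInstance, inferInstance, f.hom, ?_, (ModuleCat.mono_iff_injective f).mp hf⟩
  exact Module.injective_module_of_injective_object S I

theorem qf_noeth {S : Type u} [Ring S] (hQF : QFR S) : IsNoetherianRing S := by
  apply monotone_stabilizes_iff_noetherian.mp
  intro I
  obtain ⟨E, _, _, e, hE, he⟩ := exists_inj_embed S (∀ n, S ⧸ (I n))
  have hEp : Module.Projective S E := (hQF E).mpr hE
  have hD : Module.Projective S (ℕ →₀ E) := by
    classical
    exact Module.Projective.of_equiv (finsuppLequivDFinsupp (M := E) (ι := ℕ) S).symm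
  have hDi := (hQF _).mp hD
  let J : Ideal S := ⨆ n, I n
  have hJ : ∀ x ∈ J, ∃ n, x ∈ I n := fun x hx =>
    (Submodule.mem_iSup_of_directed _ I.monotone.directed_le).mp hx
  let c : ℕ → S →ₗ[S] E := fun n => e ∘ₗ LinearMap.single S _ n ∘ₗ (I n).mkQ
  have hc : ∀ n x, c n x = 0 ↔ x ∈ I n := by
    intro n x
    simp only [c, LinearMap.comp_apply]
    rw [map_eq_zero_iff e he]
    simp
  have hfin : ∀ x : J, (Function.support (fun n => c n x)).Finite := by
    intro x
    obtain ⟨n, hn⟩ := hJ x x.2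
    refine (Set.finite_lt_nat n).subset ?_
    intro m hm
    by_contra h
    exact hm ((hc m x).mpr (I.monotone (not_lt.mp h) hn))
  let φ : J →ₗ[S] (ℕ →₀ E) :=
    { toFun := fun x => Finsupp.ofSupportFinite (fun n => c n x) (hfin x)
      map_add' := by
        intro x y; ext n
        exact (c n).map_add x y
      map_smul' := by
        intro r x; ext n
        exact (c n).map_smul r x }
  obtain ⟨h, hh⟩ := hDi.out J.subtype J.injective_subtype φ
  obtain ⟨N, hN⟩ : ∃ N, ∀ n, N ≤ n → h 1 n = 0 := by
    obtain ⟨N, hN⟩ := (h 1).support.bddAbove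
    refine ⟨N + 1, fun n hn => ?_⟩
    by_contra hne
    have := hN (Finsupp.mem_support_iff.mpr hne)
    omega
  have key : ∀ n, N ≤ n → J ≤ I n := by
    intro n hn x hx
    rw [← hc]
    have h1 := hh ⟨x, hx⟩
    have h2 : h x = x • h 1 := by rw [← map_smul, smul_eq_mul, mul_one]
    have h3 : c n x = φ ⟨x, hx⟩ n := rfl
    rw [h3, ← h1]
    change h x n = 0
    rw [h2, Finsupp.smul_apply, hN n hn, smul_zero]
  refine ⟨N, fun m hm => le_antisymm (I.monotone hm) ?_⟩
  exact (le_iSup (fun n => I n) m).trans (key N le_rfl)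

theorem fg_embed {S : Type u} [Ring S] (hQF : QFR S) (N : Type u) [AddCommGroup N] [Module S N]
    [Module.Finite S N] :
    ∃ (F : Type u) (_ : AddCommGroup F) (_ : Module S F) (i : N →ₗ[S] F),
      Module.Finite S F ∧ Module.Projective S F ∧ Function.Injective i := by
  classical
  obtain ⟨E, _, _, e, hE, he⟩ := exists_inj_embed S N
  have hEp : Module.Projective S E := (hQF E).mpr hE
  obtain ⟨s, hs⟩ := hEp.out
  obtain ⟨G, hG⟩ := (Module.Finite.fg_top : (⊤ : Submodule S N).FG)
  let T : Finset E := G.biUnion fun x => (s (e x)).support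
  have hT : ∀ x, s (e x) ∈ Finsupp.supported S S (T : Set E) := by
    have : (⊤ : Submodule S N) ≤ (Finsupp.supported S S (T : Set E)).comap (s ∘ₗ e) := by
      rw [← hG, Submodule.span_le]
      intro x hx
      simp only [SetLike.mem_coe, Submodule.mem_comap, LinearMap.comp_apply,
        Finsupp.mem_supported]
      intro y hy
      exact Finset.mem_coe.mpr (Finset.mem_biUnion.mpr ⟨x, hx, hy⟩)
    exact fun x => this (Submodule.mem_top)
  refine ⟨T → S, inferInstance, inferInstance,
    LinearMap.pi (fun t => Finsupp.lapply (t : E) ∘ₗ s ∘ₗ e), inferInstance, inferInstance, ?_⟩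
  rw [injective_iff_map_eq_zero]
  intro x hx
  have h0 : s (e x) = 0 := by
    ext y
    by_cases hy : y ∈ T
    · exact congrFun hx ⟨y, hy⟩
    · by_contra hne
      exact hy (hT x (Finsupp.mem_support_iff.mpr hne))
  have : e x = 0 := by rw [← hs (e x), h0, map_zero]
  exact (map_eq_zero_iff e he).mp this

section
variable {S : Type u} [Ring S] {M M' P : Type u} [AddCommGroup M] [Module S M]
  [AddCommGroup M'] [Module S M'] [AddCommGroup P] [Module S P]

theorem StablyFG.congr (h : StablyFG S M) (e : M ≃ₗ[S] M') : StablyFG S M' := by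
  obtain ⟨N, P, Q, _, _, _, _, _, _, h1, h2, h3, ⟨i⟩⟩ := h
  exact ⟨N, P, Q, _, _, _, _, _, _, h1, h2, h3,
    ⟨(e.symm.prodCongr (LinearEquiv.refl S P)).trans i⟩⟩

theorem StablyFG.of_prod [Module.Projective S P] (h : StablyFG S (M × P)) : StablyFG S M := by
  obtain ⟨N, P', Q, _, _, _, _, _, _, h1, h2, h3, ⟨i⟩⟩ := h
  exact ⟨N, P × P', Q, _, inferInstance, _, _, inferInstance, _, h1, inferInstance, h3,
    ⟨(LinearEquiv.prodAssoc S M P P').symm.trans i⟩⟩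

theorem StablyFG.prod [Module.Projective S P] (h : StablyFG S M) : StablyFG S (M × P) := by
  obtain ⟨N, P', Q, _, _, _, _, _, _, h1, h2, h3, ⟨i⟩⟩ := h
  exact ⟨N, P', Q × P, _, _, inferInstance, _, _, inferInstance, h1, h2, inferInstance,
    ⟨(LinearEquiv.prodAssoc S M P P').trans
      (((LinearEquiv.refl S M).prodCongr (LinearEquiv.prodComm S P P')).trans
        ((LinearEquiv.prodAssoc S M P' P).symm.trans
          ((i.prodCongr (LinearEquiv.refl S P)).trans (LinearEquiv.prodAssoc S N Q P))))⟩⟩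

theorem StablyFG.of_fin [h : Module.Finite S M] : StablyFG S M :=
  ⟨M, PUnit, PUnit, _, inferInstance, inferInstance, _, inferInstance, inferInstance, h,
    inferInstance, inferInstance, ⟨LinearEquiv.refl S _⟩⟩

theorem split_inj (hQF : QFR S) [hP : Module.Projective S P] (b : P →ₗ[S] M)
    (hb : Function.Injective b) (g : M →ₗ[S] M') (hg : Function.Surjective g)
    (hbg : Function.Exact b g) : Nonempty ((M' × P) ≃ₗ[S] M) := by
  obtain ⟨r, hr⟩ := ((hQF P).mp hP).out b hb LinearMap.id
  exact ⟨(LinearEquiv.prodComm S M' P).trans (lequivProdOfLeftSplitExact hg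
    (LinearMap.exact_iff.mp hbg).symm (LinearMap.ext hr))⟩

theorem split_surj [hP : Module.Projective S P] (b : M' →ₗ[S] M)
    (hb : Function.Injective b) (g : M →ₗ[S] P) (hg : Function.Surjective g)
    (hbg : Function.Exact b g) : Nonempty ((M' × P) ≃ₗ[S] M) := by
  obtain ⟨r, hr⟩ := Module.projective_lifting_property g LinearMap.id hg
  exact ⟨lequivProdOfRightSplitExact hb (LinearMap.exact_iff.mp hbg).symm hr⟩

theorem StablyFG.of_coprod (hQF : QFR S) {A : Type u} [AddCommGroup A] [Module S A]
    [Module.Finite S A] [hP : Module.Projective S P] (a : A →ₗ[S] M) (b : P →ₗ[S] M)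
    (hb : Function.Injective b) (hab : ∀ m, ∃ x y, a x + b y = m) : StablyFG S M := by
  obtain ⟨i⟩ := split_inj hQF b hb (LinearMap.range b).mkQ (Submodule.mkQ_surjective _)
    (LinearMap.exact_iff.mpr (Submodule.ker_mkQ _))
  have : Module.Finite S (M ⧸ LinearMap.range b) := by
    refine Module.Finite.of_surjective ((LinearMap.range b).mkQ ∘ₗ a) ?_
    intro z
    obtain ⟨m, rfl⟩ := Submodule.mkQ_surjective _ z
    obtain ⟨x, y, rfl⟩ := hab m
    refine ⟨x, ?_⟩
    have : (LinearMap.range b).mkQ (b y) = 0 := by simp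
    rw [map_add, this, add_zero, LinearMap.comp_apply]
  exact (StablyFG.prod StablyFG.of_fin).congr i

end

section
variable {S : Type u} [Ring S]
variable {U V W : Type u} [AddCommGroup U] [Module S U] [AddCommGroup V] [Module S V]
    [AddCommGroup W] [Module S W]

theorem case_mid_core (hQF : QFR S)
    (f : U →ₗ[S] V) (g : V →ₗ[S] W)
    (hf : Function.Injective f) (hg : Function.Surjective g)
    (hfg : Function.Exact f g) {N Q N' Q' : Type u} [AddCommGroup N] [Module S N]
    [AddCommGroup Q] [Module S Q] [AddCommGroup N'] [Module S N'] [AddCommGroup Q'] [Module S Q']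
    [Module.Finite S N] [Module.Finite S N'] [Module.Projective S Q] [Module.Projective S Q']
    (eU : (N × Q) ≃ₗ[S] U) (eW : (N' × Q') ≃ₗ[S] W) : StablyFG S V := by
  obtain ⟨k, π, hπ⟩ := Module.Finite.exists_fin' S N'
  obtain ⟨t, ht⟩ := Module.projective_lifting_property g
    (eW.toLinearMap ∘ₗ LinearMap.inl S N' Q' ∘ₗ π) hg
  obtain ⟨q, hq⟩ := Module.projective_lifting_property g
    (eW.toLinearMap ∘ₗ LinearMap.inr S N' Q') hg
  have ht' : ∀ x, g (t x) = eW (π x, 0) := fun x => LinearMap.congr_fun ht x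
  have hq' : ∀ x, g (q x) = eW (0, x) := fun x => LinearMap.congr_fun hq x
  have hgf : ∀ x, g (f x) = 0 := hfg.apply_apply_eq_zero
  refine StablyFG.of_coprod hQF
    ((f ∘ₗ eU.toLinearMap ∘ₗ LinearMap.inl S N Q).coprod t)
    ((f ∘ₗ eU.toLinearMap ∘ₗ LinearMap.inr S N Q).coprod q) ?_ ?_
  · rw [injective_iff_map_eq_zero]
    rintro ⟨x, y⟩ hxy
    have hxy' : f (eU (0, x)) + q y = 0 := hxy
    have h1 := congrArg g hxy'
    rw [map_add, hgf, zero_add, map_zero, hq', LinearEquiv.map_eq_zero_iff] at h1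
    obtain rfl : y = 0 := congrArg Prod.snd h1
    rw [map_zero, add_zero, map_eq_zero_iff f hf, LinearEquiv.map_eq_zero_iff] at hxy'
    obtain rfl : x = 0 := congrArg Prod.snd hxy'
    rfl
  · intro v
    obtain ⟨⟨n', q'⟩, h1⟩ := eW.surjective (g v)
    obtain ⟨φ, rfl⟩ := hπ n'
    have h2 : g (v - t φ - q q') = 0 := by
      rw [map_sub, map_sub, ht', hq', ← h1, sub_sub, ← map_add]
      simp
    obtain ⟨u, hu⟩ := (hfg _).mp h2
    obtain ⟨⟨n, q0⟩, rfl⟩ := eU.surjective u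
    refine ⟨(n, φ), (q0, q'), ?_⟩
    change (f (eU (n, 0)) + t φ) + (f (eU (0, q0)) + q q') = v
    have h3 : (n, q0) = ((n, 0) : N × Q) + (0, q0) := by simp
    rw [h3, map_add, map_add] at hu
    rw [eq_sub_iff_add_eq, eq_sub_iff_add_eq] at hu
    rw [← hu]; abel

theorem case_mid (hQF : QFR S)
    (f : U →ₗ[S] V) (g : V →ₗ[S] W)
    (hf : Function.Injective f) (hg : Function.Surjective g)
    (hfg : Function.Exact f g) (hU : StablyFG S U) (hW : StablyFG S W) : StablyFG S V := by
  obtain ⟨N, P, Q, _, _, _, _, _, _, h1, h2, h3, ⟨i⟩⟩ := hU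
  obtain ⟨N', P', Q', _, _, _, _, _, _, h1', h2', h3', ⟨i'⟩⟩ := hW
  suffices StablyFG S (V × (P × P')) from this.of_prod
  refine case_mid_core hQF (f.prodMap (LinearMap.inl S P P')) (g.prodMap (LinearMap.snd S P P'))
    (hf.prodMap LinearMap.inl_injective) (hg.prodMap Prod.snd_surjective) ?_ i.symm i'.symm
  rintro ⟨v, p, p'⟩
  constructor
  · intro h
    obtain ⟨u, hu⟩ := (hfg v).mp (congrArg Prod.fst h)
    obtain rfl : p' = 0 := congrArg Prod.snd h
    exact ⟨(u, p), by simp [hu]⟩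
  · rintro ⟨⟨u, p0⟩, h⟩
    simp only [LinearMap.prodMap_apply, Prod.mk.injEq, LinearMap.inl_apply] at h
    obtain ⟨rfl, rfl, rfl⟩ := h
    simp [hfg.apply_apply_eq_zero]

theorem case_right_core (hQF : QFR S)
    (f : U →ₗ[S] V) (g : V →ₗ[S] W)
    (hf : Function.Injective f) (hg : Function.Surjective g)
    (hfg : Function.Exact f g) {N Q : Type u} [AddCommGroup N] [Module S N]
    [AddCommGroup Q] [Module S Q]
    [Module.Finite S N] [Module.Projective S Q]
    (eU : (N × Q) ≃ₗ[S] U) (hV : StablyFG S V) : StablyFG S W := by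
  obtain ⟨F, _, _, j, hF, hFp, hj⟩ := fg_embed hQF N
  have hX : Module.Projective S (F × Q) := inferInstance
  let i : U →ₗ[S] (F × Q) := (j.prodMap LinearMap.id) ∘ₗ eU.symm.toLinearMap
  have hi : Function.Injective i :=
    (hj.prodMap Function.injective_id).comp eU.symm.injective
  obtain ⟨e, he⟩ := ((hQF _).mp hX).out f hf i
  let k : V →ₗ[S] (W × (F × Q)) := g.prod e
  have hk : Function.Injective k := by
    rw [injective_iff_map_eq_zero]
    intro v hv
    obtain ⟨u, rfl⟩ := (hfg v).mp (congrArg Prod.fst hv)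
    have h2 : e (f u) = 0 := congrArg Prod.snd hv
    rw [he, map_eq_zero_iff i hi] at h2
    rw [h2, map_zero]
  suffices StablyFG S (W × (F × Q)) from this.of_prod
  have hfin : Module.Finite S ((W × (F × Q)) ⧸ LinearMap.range k) := by
    refine Module.Finite.of_surjective ((LinearMap.range k).mkQ ∘ₗ
      LinearMap.inr S W (F × Q) ∘ₗ LinearMap.inl S F Q) ?_
    intro z
    obtain ⟨⟨w, x⟩, rfl⟩ := Submodule.mkQ_surjective _ z
    obtain ⟨v, rfl⟩ := hg w
    refine ⟨(x - e v).1, ?_⟩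
    rw [← sub_eq_zero, LinearMap.comp_apply, ← map_sub, Submodule.mkQ_apply,
      Submodule.Quotient.mk_eq_zero]
    refine ⟨- v - f (eU (0, (x - e v).2)), ?_⟩
    have h1 : e (f (eU (0, (x - e v).2))) = (0, (x - e v).2) := by
      rw [he]; simp [i]
    have h2 : g (f (eU (0, (x - e v).2))) = 0 := hfg.apply_apply_eq_zero _
    change (g _, e _) = _
    rw [map_sub, map_sub, h1, h2]
    ext
    · simp
    · simp
    · simp only [Prod.snd_sub, Prod.snd_neg, map_neg, LinearMap.inr_apply, LinearMap.comp_apply, LinearMap.inl_apply]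
      abel
  exact case_mid hQF k (LinearMap.range k).mkQ hk (Submodule.mkQ_surjective _)
    (LinearMap.exact_iff.mpr (Submodule.ker_mkQ _)) hV StablyFG.of_fin

theorem case_right (hQF : QFR S)
    (f : U →ₗ[S] V) (g : V →ₗ[S] W)
    (hf : Function.Injective f) (hg : Function.Surjective g)
    (hfg : Function.Exact f g) (hU : StablyFG S U) (hV : StablyFG S V) : StablyFG S W := by
  obtain ⟨N, P, Q, _, _, _, _, _, _, h1, h2, h3, ⟨i⟩⟩ := hU
  refine case_right_core hQF (f.prodMap (LinearMap.id : P →ₗ[S] P)) (g ∘ₗ LinearMap.fst S V P)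
    (hf.prodMap Function.injective_id) (hg.comp LinearMap.fst_surjective) ?_ i.symm hV.prod
  rintro ⟨v, p⟩
  constructor
  · intro h
    obtain ⟨u, hu⟩ := (hfg v).mp h
    exact ⟨(u, p), by simp [hu]⟩
  · rintro ⟨⟨u, p0⟩, h⟩
    simp only [LinearMap.prodMap_apply, Prod.mk.injEq] at h
    obtain ⟨rfl, rfl⟩ := h
    exact hfg.apply_apply_eq_zero _

theorem case_left_core (hQF : QFR S)
    (f : U →ₗ[S] V) (g : V →ₗ[S] W)
    (hf : Function.Injective f) (hg : Function.Surjective g)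
    (hfg : Function.Exact f g) {N Q : Type u} [AddCommGroup N] [Module S N]
    [AddCommGroup Q] [Module S Q]
    [Module.Finite S N] [Module.Projective S Q]
    (eW : (N × Q) ≃ₗ[S] W) (hV : StablyFG S V) : StablyFG S U := by
  have := qf_noeth hQF
  obtain ⟨k, π, hπ⟩ := Module.Finite.exists_fin' S N
  let h : ((Fin k → S) × Q) →ₗ[S] W := eW.toLinearMap ∘ₗ π.prodMap LinearMap.id
  have hh : Function.Surjective h := eW.surjective.comp (hπ.prodMap Function.surjective_id)
  let E : Submodule S (V × ((Fin k → S) × Q)) :=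
    LinearMap.ker (g ∘ₗ LinearMap.fst S V _ - h ∘ₗ LinearMap.snd S V _)
  have hE : ∀ v x, (v, x) ∈ E ↔ g v = h x := by
    intro v x; simp [E, sub_eq_zero]
  have hgf : ∀ x, g (f x) = 0 := hfg.apply_apply_eq_zero
  -- U → E → X
  obtain ⟨i⟩ := split_surj (P := (Fin k → S) × Q)
    (LinearMap.codRestrict E (LinearMap.inl S V ((Fin k → S) × Q) ∘ₗ f)
      (fun u => (hE _ _).mpr ((hgf u).trans (map_zero h).symm)))
    (fun a b hab => hf (congrArg (fun z : E => z.1.1) hab))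
    (LinearMap.snd S V _ ∘ₗ E.subtype)
    (fun x => by
      obtain ⟨v, hv⟩ := hg (h x)
      exact ⟨⟨(v, x), (hE _ _).mpr hv⟩, rfl⟩)
    (by
      rintro ⟨⟨v, x⟩, hvx⟩
      constructor
      · intro h0
        obtain rfl : x = 0 := h0
        have h1 := (hE _ _).mp hvx
        rw [map_zero] at h1
        obtain ⟨u, rfl⟩ := (hfg v).mp h1
        exact ⟨u, rfl⟩
      · rintro ⟨u, hu⟩
        exact (congrArg (fun z : E => z.1.2) hu).symm)
  suffices StablyFG S E from (this.congr i.symm).of_prod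
  have hK : ∀ x : LinearMap.ker π, h ((x : Fin k → S), 0) = 0 := by
    intro x
    have : π x = 0 := x.2
    simp [h, this]
  refine case_mid hQF (U := LinearMap.ker π)
    (LinearMap.codRestrict E (LinearMap.inr S V _ ∘ₗ LinearMap.inl S _ Q ∘ₗ (LinearMap.ker π).subtype)
      (fun x => (hE _ _).mpr ((map_zero g).trans (hK x).symm)))
    (LinearMap.fst S V _ ∘ₗ E.subtype)
    (fun a b hab => Subtype.ext (congrArg (fun z : E => z.1.2.1) hab))
    (fun v => by
      obtain ⟨x, hx⟩ := hh (g v)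
      exact ⟨⟨(v, x), (hE _ _).mpr hx.symm⟩, rfl⟩)
    ?_ StablyFG.of_fin hV
  rintro ⟨⟨v, x, q⟩, hvx⟩
  constructor
  · intro h0
    obtain rfl : v = 0 := h0
    have h1 := (hE _ _).mp hvx
    rw [map_zero] at h1
    have h2 : eW (π x, q) = 0 := h1.symm
    rw [LinearEquiv.map_eq_zero_iff] at h2
    obtain rfl : q = 0 := congrArg Prod.snd h2
    exact ⟨⟨x, congrArg Prod.fst h2⟩, rfl⟩
  · rintro ⟨u, hu⟩
    exact (congrArg (fun z : E => z.1.1) hu).symm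

theorem case_left (hQF : QFR S)
    (f : U →ₗ[S] V) (g : V →ₗ[S] W)
    (hf : Function.Injective f) (hg : Function.Surjective g)
    (hfg : Function.Exact f g) (hV : StablyFG S V) (hW : StablyFG S W) : StablyFG S U := by
  obtain ⟨N, P, Q, _, _, _, _, _, _, h1, h2, h3, ⟨i⟩⟩ := hW
  refine case_left_core hQF (LinearMap.inl S V P ∘ₗ f) (g.prodMap (LinearMap.id : P →ₗ[S] P))
    (LinearMap.inl_injective.comp hf) (hg.prodMap Function.surjective_id) ?_ i.symm hV.prod
  rintro ⟨v, p⟩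
  constructor
  · intro h
    obtain ⟨u, hu⟩ := (hfg v).mp (congrArg Prod.fst h)
    obtain rfl : p = 0 := congrArg Prod.snd h
    exact ⟨u, by simp [hu]⟩
  · rintro ⟨u, h⟩
    simp only [LinearMap.comp_apply, Prod.mk.injEq, LinearMap.inl_apply] at h
    obtain ⟨rfl, rfl⟩ := h
    simp [hfg.apply_apply_eq_zero]

end

/-- Let S be a quasi-Frobenius ring (a left module is projective iff injective)
and 0 → U → V → W → 0 a short exact sequence of left S-modules. If two of U, V, W are
stably finitely generated then so is the third. -/
theorem stmt4 {S : Type u} [Ring S]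
    (hQF : ∀ (M : Type u) [AddCommGroup M] [Module S M],
      Module.Projective S M ↔ Module.Injective S M)
    {U V W : Type u} [AddCommGroup U] [Module S U] [AddCommGroup V] [Module S V]
    [AddCommGroup W] [Module S W]
    (f : U →ₗ[S] V) (g : V →ₗ[S] W)
    (hf : Function.Injective f) (hg : Function.Surjective g)
    (hfg : Function.Exact f g) :
    (StablyFG S U ∧ StablyFG S V → StablyFG S W) ∧
    (StablyFG S U ∧ StablyFG S W → StablyFG S V) ∧
    (StablyFG S V ∧ StablyFG S W → StablyFG S U) := by
  exact ⟨fun h => case_right hQF f g hf hg hfg h.1 h.2, fun h => case_mid hQF f g hf hg hfg h.1 h.2,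
    fun h => case_left hQF f g hf hg hfg h.1 h.2⟩
end

section
/- Let S be a finite-dimensional quasi-Frobenius algebra over a field k and let M be a left S-module. Then the following are equivalent: (i) M is stably finitely generated; (ii) for every finitely generated S-module V, the quotient k-vector space Hom_S(V, M)/PHom_S(V, M) is finite-dimensional over k; (iii) for every simple S-module V, Hom_S(V, M)/PHom_S(V, M) is finite-dimensional over k. -/
universe u

/-- `PHom k S V M` is the `k`-subspace of `Hom_S(V, M)` consisting of the `S`-module
homomorphisms `V → M` that factor through some projective `S`-module. -/
def PHom (k S : Type u) [Field k] [Ring S] [Algebra k S]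
    (V M : Type u) [AddCommGroup V] [Module S V]
    [AddCommGroup M] [Module S M] [Module k M] [SMulCommClass S k M] :
    Submodule k (V →ₗ[S] M) where
  carrier := {f | ∃ (P : Type u) (_ : AddCommGroup P) (_ : Module S P),
    Module.Projective S P ∧ ∃ (α : V →ₗ[S] P) (β : P →ₗ[S] M), f = β.comp α}
  zero_mem' :=
    ⟨S, inferInstance, inferInstance, inferInstance, 0, 0, by ext v; simp⟩
  add_mem' := by
    rintro f g ⟨P, _, _, hP, α, β, rfl⟩ ⟨Q, _, _, hQ, γ, δ, rfl⟩
    exact ⟨P × Q, inferInstance, inferInstance, inferInstance,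
      α.prod γ, β.coprod δ, by ext v; simp⟩
  smul_mem' := by
    rintro c f ⟨P, _, _, hP, α, β, rfl⟩
    exact ⟨P, ‹_›, ‹_›, hP, α, c • β, by ext v; simp⟩


theorem aux_fit {S : Type u} [Ring S] [IsArtinianRing S] [IsNoetherianRing S]
    (hQF : ∀ (P : Type u) [AddCommGroup P] [Module S P],
      Module.Projective S P ↔ Module.Injective S P)
    {V M : Type u} [AddCommGroup V] [Module S V] [AddCommGroup M] [Module S M]
    (l : ℕ∞) :
    ∀ (E : Type u) [AddCommGroup E] [Module S E] [Module.Finite S E] [Module.Projective S E],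
      Module.length S E = l → ∀ (α : V →ₗ[S] E) (β : E →ₗ[S] M), 
      Function.Injective (β.comp α) → ∃ (E' : Type u) (_ : AddCommGroup E') (_ : Module S E')
        (α : V →ₗ[S] E') (β : E' →ₗ[S] M),
        Module.Projective S E' ∧ Function.Injective α ∧ Function.Injective β := by
  induction l using WellFoundedLT.induction with
  | ind l ih =>
  intro E _ _ _ _ hl α β hinj
  have hα : Function.Injective α := by
    rw [LinearMap.coe_comp] at hinj; exact hinj.of_comp
  by_cases hβ : Function.Injective β
  · exact ⟨E, _, _, α, β, inferInstance, hα, hβ⟩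
  have hE : Module.Injective S E := (hQF E).1 inferInstance
  obtain ⟨γ, hγ⟩ := hE.out ((LinearMap.ker β).mkQ.comp α) (by
    rw [← LinearMap.ker_eq_bot, LinearMap.ker_eq_bot']
    intro v hv
    have : α v ∈ LinearMap.ker β := by simpa using hv
    exact hinj (by simpa using this)) α
  let φ : Module.End S E := γ.comp (LinearMap.ker β).mkQ
  have hφ : ∀ v, φ (α v) = α v := hγ
  have hφn : ∀ (n : ℕ) v, (φ ^ n) (α v) = α v := by
    intro n v
    induction n with
    | zero => rfl
    | succ n ih => rw [pow_succ, Module.End.mul_apply, hφ, ih]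
  obtain ⟨n, hn, hn1⟩ := ((φ.eventually_isCompl_ker_pow_range_pow).and
    (Filter.eventually_ge_atTop 1)).exists
  obtain ⟨x, hx, hx0⟩ : ∃ x, β x = 0 ∧ x ≠ 0 := by
    by_contra! h
    exact hβ ((injective_iff_map_eq_zero β).2 h)
  have hxn : (φ ^ n) x = 0 := by
    obtain ⟨m, rfl⟩ := Nat.exists_eq_add_of_le' hn1
    rw [pow_succ, Module.End.mul_apply]
    have : φ x = 0 := by
      have : (LinearMap.ker β).mkQ x = 0 := by simpa using hx
      simp only [φ, LinearMap.comp_apply, this, map_zero]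
    rw [this, map_zero]
  have hne : LinearMap.range (φ ^ n) ≠ ⊤ := by
    intro h
    have := hn.disjoint
    rw [h, disjoint_top] at this
    have hx' : x ∈ LinearMap.ker (φ ^ n) := hxn
    rw [this] at hx'
    exact hx0 (by simpa using hx')
  have hP : Module.Projective S (LinearMap.range (φ ^ n)) :=
    Module.Projective.of_split (LinearMap.range (φ ^ n)).subtype
      (Submodule.projectionOnto _ _ hn.symm) (by
        ext y
        exact congrArg Subtype.val (Submodule.projectionOnto_apply_left hn.symm y))
  refine ih _ ?_ (LinearMap.range (φ ^ n)) rfl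
    (α.codRestrict _ fun v => ⟨α v, hφn n v⟩) (β.comp (Submodule.subtype _)) ?_
  · rw [← hl]
    exact Submodule.length_lt (lt_top_iff_ne_top.2 hne).ne
  · exact hinj

theorem aux_red {S : Type u} [Ring S] [IsArtinianRing S] [IsNoetherianRing S]
    (hQF : ∀ (P : Type u) [AddCommGroup P] [Module S P],
      Module.Projective S P ↔ Module.Injective S P)
    {V M : Type u} [AddCommGroup V] [Module S V] [IsSimpleModule S V]
    [AddCommGroup M] [Module S M]
    (hM : ∀ Q : Submodule S M, Module.Injective S Q → Q = ⊥)
    (P : Type u) [AddCommGroup P] [Module S P] [Module.Projective S P]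
    (α : V →ₗ[S] P) (β : P →ₗ[S] M) : β.comp α = 0 := by
  classical
  by_contra hne
  have hinj : Function.Injective (β.comp α) :=
    (LinearMap.injective_or_eq_zero _).resolve_right hne
  obtain ⟨s, hs⟩ := (Module.projective_def (R := S) (P := P)).1 inferInstance
  have := IsSimpleModule.nontrivial S V
  obtain ⟨v, hv⟩ := exists_ne (0 : V)
  let T : Set P := ((s (α v)).support : Set P)
  have key : ∀ w, s (α w) ∈ Finsupp.supported S S T := by
    intro w
    obtain ⟨r, rfl⟩ := IsSimpleModule.toSpanSingleton_surjective S hv w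
    simp only [LinearMap.toSpanSingleton_apply, map_smul]
    apply Submodule.smul_mem
    exact fun _ h => h
  have : Module.Finite S (Finsupp.supported S S T) :=
    Module.Finite.equiv (Finsupp.supportedEquivFinsupp (R := S) (M := S) T).symm
  have : Module.Projective S (Finsupp.supported S S T) :=
    Module.Projective.of_equiv' (Finsupp.supportedEquivFinsupp (R := S) (M := S) T).symm
  obtain ⟨E, _, _, a, b, hE, ha, hb⟩ := aux_fit hQF _ (Finsupp.supported S S T) rfl
    ((s.comp α).codRestrict _ key)
    ((β.comp (Finsupp.linearCombination S id)).comp (Submodule.subtype _)) (by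
      intro x y hxy
      apply hinj
      simpa [hs (α _)] using hxy)
  have h1 : Module.Projective S (LinearMap.range b) :=
    Module.Projective.of_equiv' (LinearEquiv.ofInjective b hb)
  have h2 := hM _ ((hQF _).1 h1)
  rw [LinearMap.range_eq_bot] at h2
  subst h2
  exact hv (ha (hb (by simp)))

theorem aux_findim {k S : Type u} [Field k] [Ring S] [Algebra k S] 
    (M : Type u) [AddCommGroup M] [Module S M] [Module k M] [SMulCommClass S k M]
    (h : ∀ (V : Type u) [AddCommGroup V] [Module S V], IsSimpleModule S V →
      FiniteDimensional k (V →ₗ[S] M))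
    (V : Type u) [AddCommGroup V] [Module S V] (hV : IsFiniteLength S V) :
    FiniteDimensional k (V →ₗ[S] M) := by
  induction hV with
  | of_subsingleton =>
    infer_instance
  | @of_simple_quotient V _ _ N hs hN ih =>
    have h1 := h _ hs
    let r : (V →ₗ[S] M) →ₗ[k] (N →ₗ[S] M) :=
      { toFun := fun f => f.comp N.subtype
        map_add' := fun _ _ => rfl
        map_smul' := fun _ _ => rfl }
    let q : ((V ⧸ N) →ₗ[S] M) →ₗ[k] (V →ₗ[S] M) :=
      { toFun := fun f => f.comp N.mkQ
        map_add' := fun _ _ => rfl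
        map_smul' := fun _ _ => rfl }
    have hex : LinearMap.ker r ≤ LinearMap.range q := by
      intro f hf
      refine ⟨N.liftQ f fun x hx => ?_, ?_⟩
      · exact LinearMap.congr_fun (show f.comp N.subtype = 0 from hf) ⟨x, hx⟩
      · exact N.liftQ_mkQ f _
    have : FiniteDimensional k (LinearMap.ker r) :=
      Submodule.finiteDimensional_of_le hex
    have : FiniteDimensional k (LinearMap.range r) := inferInstance
    have : FiniteDimensional k ((V →ₗ[S] M) ⧸ LinearMap.ker r) :=
      Module.Finite.equiv r.quotKerEquivRange.symm
    exact Module.Finite.of_submodule_quotient (LinearMap.ker r)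

theorem aux_max {S : Type u} [Ring S] [IsNoetherianRing S]
    (M : Type u) [AddCommGroup M] [Module S M] :
    ∃ P M' : Submodule S M, IsCompl P M' ∧ Module.Injective S P ∧
      ∀ Q : Submodule S M', Module.Injective S Q → Q = ⊥ := by
  obtain ⟨P, -, hP⟩ := zorn_le_nonempty₀ {P : Submodule S M | Module.Injective S P} (by
    intro c hc hch y hy
    refine ⟨sSup c, ?_, fun z hz => le_sSup hz⟩
    apply Module.Baer.injective
    intro I g
    have hfg : (LinearMap.range ((sSup c).subtype.comp g)).FG := by
      rw [LinearMap.range_eq_map]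
      exact (IsNoetherian.noetherian (⊤ : Submodule S I)).map _
    have : ∃ z ∈ c, LinearMap.range ((sSup c).subtype.comp g) ≤ z := by
      have hcomp := (Submodule.fg_iff_compact _).1 hfg
      exact (CompleteLattice.isCompactElement_iff_le_of_directed_sSup_le _ _).1 hcomp c ⟨y, hy⟩
        hch.directedOn (by rintro _ ⟨x, rfl⟩; exact (g x).2)
    obtain ⟨z, hz, hle⟩ := this
    have hzi : Module.Injective S z := hc hz
    obtain ⟨g', hg'⟩ := Module.Baer.of_injective hzi I
      (((sSup c).subtype.comp g).codRestrict z fun x => hle ⟨x, rfl⟩)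
    refine ⟨(Submodule.inclusion (le_sSup hz)).comp g', fun x hx => ?_⟩
    apply Subtype.ext
    simp [hg' x hx]) ⊥ (by
      constructor
      intro X Y _ _ _ _ f hf g
      exact ⟨0, fun x => Subsingleton.elim _ _⟩)
  have hPi : Module.Injective S P := hP.1
  obtain ⟨p, hp⟩ := hPi.out P.subtype P.injective_subtype LinearMap.id
  have hc : IsCompl P (LinearMap.ker p) := LinearMap.isCompl_of_proj hp
  refine ⟨P, LinearMap.ker p, hc, hPi, fun Q hQ => ?_⟩
  let Q' : Submodule S M := Q.map (LinearMap.ker p).subtype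
  let j : (P × Q) →ₗ[S] M := P.subtype.coprod ((LinearMap.ker p).subtype.comp Q.subtype)
  have hj : Function.Injective j := by
    rw [injective_iff_map_eq_zero]
    rintro ⟨a, b⟩ hab
    have h0 : (a : M) + (b : M) = 0 := hab
    have h1 : a = 0 := by
      have := congrArg p h0
      rw [map_add, map_zero, show p ((b : LinearMap.ker p) : M) = 0 from b.1.2, add_zero] at this
      rw [← this]; exact (hp a).symm
    subst h1
    have h2 : b = 0 := by
      apply Subtype.ext; apply Subtype.ext; simpa using h0
    rw [h2]; rfl
  have hprod : Module.Injective S (P × Q) := by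
    constructor
    intro X Y _ _ _ _ f hf g
    obtain ⟨h1, hh1⟩ := hPi.out f hf ((LinearMap.fst S P Q).comp g)
    obtain ⟨h2, hh2⟩ := hQ.out f hf ((LinearMap.snd S P Q).comp g)
    exact ⟨h1.prod h2, fun x => Prod.ext (hh1 x) (hh2 x)⟩
  have hr : Module.Injective S (LinearMap.range j) :=
    Module.Baer.injective (Module.Baer.of_equiv (LinearEquiv.ofInjective j hj)
      (Module.Baer.of_injective hprod))
  have hle : LinearMap.range j ≤ P := hP.2 hr (fun x hx => ⟨(⟨x, hx⟩, 0), by simp [j]⟩)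
  rw [eq_bot_iff]
  intro x hx
  have h3 : ((x : LinearMap.ker p) : M) ∈ P := hle ⟨(0, ⟨x, hx⟩), by simp [j]⟩
  have := Submodule.disjoint_def.1 hc.disjoint _ h3 x.2
  rw [Submodule.mem_bot]
  exact Subtype.ext this

theorem aux_12 {k S : Type u} [Field k] [Ring S] [Algebra k S] [FiniteDimensional k S]
    (M : Type u) [AddCommGroup M] [Module S M] [Module k M] [IsScalarTower k S M]
    [SMulCommClass S k M] (hM : StablyFG S M)
    (V : Type u) [AddCommGroup V] [Module S V] [Module.Finite S V] :
    FiniteDimensional k ((V →ₗ[S] M) ⧸ PHom k S V M) := by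
  obtain ⟨N, P, Q, _, _, _, _, _, _, hN, hP, hQ, ⟨e⟩⟩ := hM
  letI : Module k N := Module.compHom N (algebraMap k S)
  have : IsScalarTower k S N := ⟨fun a b c => by
    rw [Algebra.smul_def, mul_smul]; rfl⟩
  have : SMulCommClass S k N := ⟨fun a b c => by
    change a • (algebraMap k S b) • c = (algebraMap k S b) • a • c
    rw [smul_smul, smul_smul, Algebra.commutes]⟩
  letI : Module k V := Module.compHom V (algebraMap k S)
  have : IsScalarTower k S V := ⟨fun a b c => by
    rw [Algebra.smul_def, mul_smul]; rfl⟩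
  have : FiniteDimensional k N := Module.Finite.trans S N
  have : FiniteDimensional k V := Module.Finite.trans S V
  let res : (V →ₗ[S] N) →ₗ[k] (V →ₗ[k] N) :=
    { toFun := fun f => f.restrictScalars k
      map_add' := fun _ _ => rfl
      map_smul' := fun _ _ => rfl }
  have : FiniteDimensional k (V →ₗ[S] N) := Module.Finite.of_injective res
    (fun f g h => LinearMap.restrictScalars_injective k h)
  let u : N →ₗ[S] M := (LinearMap.fst S M P).comp (e.symm.toLinearMap.comp (LinearMap.inl S N Q))
  let w : Q →ₗ[S] M := (LinearMap.fst S M P).comp (e.symm.toLinearMap.comp (LinearMap.inr S N Q))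
  have hu : ∀ (c : k) x, u (c • x) = c • u x := by
    intro c x
    rw [← algebraMap_smul S c x, map_smul, algebraMap_smul]
  let t : (V →ₗ[S] N) →ₗ[k] (V →ₗ[S] M) :=
    { toFun := fun f => u.comp f
      map_add' := fun f g => LinearMap.comp_add _ _ _
      map_smul' := fun c f => by ext x; exact hu c (f x) }
  apply Module.Finite.of_surjective ((PHom k S V M).mkQ.comp t)
  intro y
  obtain ⟨f, rfl⟩ := Submodule.mkQ_surjective _ y
  let g : V →ₗ[S] N × Q := e.toLinearMap.comp ((LinearMap.inl S M P).comp f)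
  refine ⟨(LinearMap.fst S N Q).comp g, ?_⟩
  rw [LinearMap.comp_apply, eq_comm, Submodule.mkQ_apply, Submodule.mkQ_apply, Submodule.Quotient.eq]
  refine ⟨Q, _, _, hQ, (LinearMap.snd S N Q).comp g, w, ?_⟩
  rw [sub_eq_iff_eq_add]
  ext v
  have : f v = (e.symm (g v)).1 := by simp [g]
  rw [this]
  have h2 : g v = ((0 : N), (g v).2) + ((g v).1, (0 : Q)) := by simp
  rw [h2, map_add]
  simp [t, u, w]

theorem aux_31 {k S : Type u} [Field k] [Ring S] [Algebra k S] [FiniteDimensional k S]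
    (hQF : ∀ (P : Type u) [AddCommGroup P] [Module S P],
      Module.Projective S P ↔ Module.Injective S P)
    (M : Type u) [AddCommGroup M] [Module S M] [Module k M] [IsScalarTower k S M]
    [SMulCommClass S k M]
    (h : ∀ (V : Type u) (_ : AddCommGroup V) (_ : Module S V), IsSimpleModule S V →
        FiniteDimensional k ((V →ₗ[S] M) ⧸ PHom k S V M)) : StablyFG S M := by
  have : IsArtinianRing S := IsArtinianRing.of_finite k S
  have : IsNoetherianRing S := IsNoetherianRing.of_finite k S
  obtain ⟨P, M', hc, hP, hM'⟩ := aux_max (S := S) M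
  have : SMulCommClass S k M' := ⟨fun a b c => Subtype.ext (smul_comm a b (c : M))⟩
  have h1 : FiniteDimensional k (S →ₗ[S] M') := by
    apply aux_findim
    · intro V _ _ hV
      have := h V _ _ hV
      let t : (V →ₗ[S] M') →ₗ[k] (V →ₗ[S] M) :=
        { toFun := fun f => M'.subtype.comp f
          map_add' := fun _ _ => rfl
          map_smul' := fun _ _ => rfl }
      apply Module.Finite.of_injective ((PHom k S V M).mkQ.comp t)
      rw [injective_iff_map_eq_zero]
      intro f hf
      rw [LinearMap.comp_apply, Submodule.mkQ_apply, Submodule.Quotient.mk_eq_zero] at hf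
      obtain ⟨E, _, _, hE, α, β, hab⟩ := hf
      have h0 := aux_red hQF hM' E α ((Submodule.projectionOnto M' P hc.symm).comp β)
      rw [LinearMap.comp_assoc, ← hab] at h0
      rw [← h0]
      ext v
      exact congrArg Subtype.val (Submodule.projectionOnto_apply_left hc.symm (f v)).symm
    · exact isFiniteLength_iff_isNoetherian_isArtinian.2 ⟨inferInstance, inferInstance⟩
  have : FiniteDimensional k M' :=
    Module.Finite.of_surjective
      ({ toFun := fun f => f 1
         map_add' := fun _ _ => rfl
         map_smul' := fun _ _ => rfl } : (S →ₗ[S] M') →ₗ[k] M')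
      (fun x => ⟨LinearMap.toSpanSingleton S M' x, by simp⟩)
  have : Module.Finite S M' := Module.Finite.of_restrictScalars_finite k S M'
  refine ⟨M', PUnit, P, inferInstance, inferInstance, inferInstance, inferInstance, inferInstance,
    inferInstance, this, inferInstance, (hQF _).2 hP, ⟨?_⟩⟩
  exact LinearEquiv.prodUnique.trans (Submodule.prodEquivOfIsCompl M' P hc.symm).symm

theorem stmt5 {k S : Type u} [Field k] [Ring S] [Algebra k S] [FiniteDimensional k S]
    (hQF : ∀ (P : Type u) [AddCommGroup P] [Module S P],
      Module.Projective S P ↔ Module.Injective S P)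
    (M : Type u) [AddCommGroup M] [Module S M] [Module k M] [IsScalarTower k S M]
    [SMulCommClass S k M] :
    (StablyFG S M ↔
      ∀ (V : Type u) (_ : AddCommGroup V) (_ : Module S V), Module.Finite S V →
        FiniteDimensional k ((V →ₗ[S] M) ⧸ PHom k S V M)) ∧
    (StablyFG S M ↔
      ∀ (V : Type u) (_ : AddCommGroup V) (_ : Module S V), IsSimpleModule S V →
        FiniteDimensional k ((V →ₗ[S] M) ⧸ PHom k S V M)) := by
  refine ⟨⟨fun h V _ _ _ => aux_12 M h V, fun h => aux_31 hQF M fun V _ _ _ => h V _ _ inferInstance⟩,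
    ⟨fun h V _ _ _ => aux_12 M h V, fun h => aux_31 hQF M h⟩⟩
end

section
/- Let H be a finite-dimensional Hopf algebra over a field k with counit ε, antipode S, comultiplication Δ (written Δ(h) = Σ h₁ ⊗ h₂), and a nonzero left integral Λ ∈ H. Let V be a finitely generated left H-module and M any left H-module. Then an H-module homomorphism g : V → M factors through a projective H-module if and only if there exists a k-linear map f : V → M such that g(v) = Σ Λ₁ · f(S(Λ₂) · v) for all v ∈ V. -/
universe u
open TensorProduct
namespace Aux7
open Coalgebra HopfAlgebra
variable {k H : Type u} [Field k] [Ring H] [HopfAlgebra k H]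

/-- The map `(a ⊗ b) ⊗ c ↦ (id ⊗ S)((a ⊗ b) t) (1 ⊗ c)`. -/
noncomputable def Gam (t : H ⊗[k] H) : (H ⊗[k] H) ⊗[k] H →ₗ[k] H ⊗[k] H :=
  TensorProduct.lift
    ((LinearMap.mul k (H ⊗[k] H)).compl₁₂ ((antipode k).lTensor H ∘ₗ LinearMap.mulRight k t)
      (Algebra.TensorProduct.includeRight : H →ₐ[k] H ⊗[k] H).toLinearMap)

lemma Gam_tmul (t s : H ⊗[k] H) (c : H) :
    Gam t (s ⊗ₜ c) = (antipode k).lTensor H (s * t) * (1 ⊗ₜ c) := by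
  simp [Gam]

lemma Gam_assoc (t : H ⊗[k] H) (a : H) (w : H ⊗[k] H) :
    Gam t ((TensorProduct.assoc k H H H).symm (a ⊗ₜ w)) =
      (a ⊗ₜ[k] 1) * (antipode k).lTensor H t *
        (1 ⊗ₜ[k] LinearMap.mul' k H ((antipode k).rTensor H w)) := by
  induction w with
  | zero => simp
  | add x y hx hy => simp only [tmul_add, map_add, hx, hy, mul_add]
  | tmul b c =>
    rw [TensorProduct.assoc_symm_tmul, Gam_tmul]
    induction t with
    | zero => simp
    | add x y hx hy => simp only [map_add, hx, hy, mul_add, add_mul]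
    | tmul x y => simp [antipode_mul_antidistrib, mul_assoc]

lemma casimir (Λ : H) (hint : ∀ h : H, h * Λ = Coalgebra.counit (R := k) h • Λ) (h : H) :
    ((h ⊗ₜ[k] 1) * (antipode k).lTensor H (comul (R := k) Λ)) =
      (antipode k).lTensor H (comul (R := k) Λ) * (1 ⊗ₜ[k] h) := by
  set E := (antipode k).lTensor H (comul (R := k) Λ) with hE
  have key := congrArg (Gam (comul (R := k) Λ)) (coassoc_symm_apply (R := k) h)
  have h1 : Gam (comul (R := k) Λ) ∘ₗ (comul (R := k) (A := H)).rTensor H =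
      LinearMap.mulLeft k E ∘ₗ
        (TensorProduct.mk k H H 1) ∘ₗ (TensorProduct.lid k H).toLinearMap ∘ₗ
          (counit (R := k) (A := H)).rTensor H := by
    ext a c
    simp [Gam_tmul, ← Bialgebra.comul_mul, hint, hE]
  have h2 : Gam (comul (R := k) Λ) ∘ₗ (TensorProduct.assoc k H H H).symm.toLinearMap ∘ₗ
        (comul (R := k) (A := H)).lTensor H =
      LinearMap.mulRight k E ∘ₗ
        ((TensorProduct.mk k H H).flip 1) ∘ₗ (TensorProduct.rid k H).toLinearMap ∘ₗ
          (counit (R := k) (A := H)).lTensor H := by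
    ext a c
    simp [Gam_assoc, hE, Algebra.algebraMap_eq_smul_one, ← Algebra.TensorProduct.one_def,
      smul_tmul']
    rw [← smul_tmul', smul_mul_assoc]
  have h1' := LinearMap.congr_fun h1 (comul h)
  have h2' := LinearMap.congr_fun h2 (comul h)
  simp at h1' h2'
  rw [← h1', ← h2']

lemma inj (Λ : H) (hΛ0 : Λ ≠ 0) [FiniteDimensional k H]
    (hint : ∀ h : H, h * Λ = Coalgebra.counit (R := k) h • Λ) (l : H →ₗ[k] k)
    (hl : TensorProduct.rid k H ((l ∘ₗ antipode k).lTensor H (comul (R := k) Λ)) = 0) : l = 0 := by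
  -- `K h c = l (S c * h)`
  let K : H → (H →ₗ[k] k) := fun h => l ∘ₗ LinearMap.mulRight k h ∘ₗ antipode k
  have hA : ∀ h, TensorProduct.rid k H ((K h).lTensor H (comul (R := k) Λ)) = 0 := by
    intro h
    have e1 := congrArg (fun t => TensorProduct.rid k H (l.lTensor H t)) (casimir Λ hint h)
    have e2 : (TensorProduct.rid k H).toLinearMap ∘ₗ l.lTensor H ∘ₗ
        LinearMap.mulLeft k (h ⊗ₜ[k] (1 : H)) ∘ₗ (antipode k).lTensor H =
        LinearMap.mulLeft k h ∘ₗ (TensorProduct.rid k H).toLinearMap ∘ₗ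
          (l ∘ₗ antipode k).lTensor H := by
      ext a c; simp
    have e3 : (TensorProduct.rid k H).toLinearMap ∘ₗ l.lTensor H ∘ₗ
        LinearMap.mulRight k ((1 : H) ⊗ₜ[k] h) ∘ₗ (antipode k).lTensor H =
        (TensorProduct.rid k H).toLinearMap ∘ₗ (K h).lTensor H := by
      ext a c; simp [K]
    have e2' := LinearMap.congr_fun e2 (comul Λ)
    have e3' := LinearMap.congr_fun e3 (comul Λ)
    simp only [LinearMap.comp_apply, LinearEquiv.coe_coe, LinearMap.mulLeft_apply,
      LinearMap.mulRight_apply] at e2' e3'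
    rw [← e3', ← e1]
    simp only [e2', hl, mul_zero]
  set U := (comul (R := k) (A := H)).rTensor H (comul Λ) with hU
  have hB : ∀ h, TensorProduct.rid k (H ⊗[k] H) ((K h).lTensor (H ⊗[k] H) U) = 0 := by
    intro h
    have e : (TensorProduct.rid k (H ⊗[k] H)).toLinearMap ∘ₗ (K h).lTensor (H ⊗[k] H) ∘ₗ
        (comul (R := k) (A := H)).rTensor H =
        comul (R := k) (A := H) ∘ₗ (TensorProduct.rid k H).toLinearMap ∘ₗ (K h).lTensor H := by
      ext a c; simp
    have e' := LinearMap.congr_fun e (comul Λ)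
    simp only [LinearMap.comp_apply, LinearEquiv.coe_coe, hA, map_zero] at e'
    exact e'
  ext h'
  let b := Module.finBasis k H
  let φ := fun i => b.coord i ∘ₗ LinearMap.mulRight k h' ∘ₗ antipode k ∘ₗ antipode k
  -- contraction
  let C : (H ⊗[k] H) ⊗[k] H →ₗ[k] H := ∑ i, (TensorProduct.rid k H).toLinearMap ∘ₗ
    (φ i).lTensor H ∘ₗ (TensorProduct.rid k (H ⊗[k] H)).toLinearMap ∘ₗ (K (b i)).lTensor (H ⊗[k] H)
  have hC0 : C U = 0 := by
    simp [C, hB, LinearMap.sum_apply]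
  have hC : ∀ x y z : H, C ((x ⊗ₜ y) ⊗ₜ z) = l (antipode k (antipode k y * z) * h') • x := by
    intro x y z
    have := congrArg (fun w => l (antipode k z * w)) (b.sum_repr (antipode k (antipode k y) * h'))
    simp only [Finset.mul_sum, map_sum, mul_smul_comm, map_smul, smul_eq_mul] at this
    simp only [antipode_mul_antidistrib, mul_assoc, ← this, Finset.sum_smul]
    simp [C, φ, K, LinearMap.sum_apply, smul_smul, mul_comm]
  have hC2 : C ∘ₗ (TensorProduct.assoc k H H H).symm.toLinearMap =
      (TensorProduct.rid k H).toLinearMap ∘ₗ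
        (l ∘ₗ LinearMap.mulRight k h' ∘ₗ antipode k ∘ₗ LinearMap.mul' k H ∘ₗ
          (antipode k).rTensor H).lTensor H := by
    ext x y z
    simp [hC]
  have hC3 : C ∘ₗ (TensorProduct.assoc k H H H).symm.toLinearMap ∘ₗ (comul (R := k)).lTensor H =
      l h' • (TensorProduct.rid k H).toLinearMap ∘ₗ (counit (R := k) (A := H)).lTensor H := by
    rw [← LinearMap.comp_assoc, hC2]
    ext x y
    simp [Algebra.algebraMap_eq_smul_one, smul_smul, mul_comm]
  have := LinearMap.congr_fun hC3 (comul Λ)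
  simp only [LinearMap.comp_apply, LinearEquiv.coe_coe, coassoc_symm_apply, ← hU, hC0] at this
  simp at this
  simpa [hΛ0] using this.symm

lemma exists_one (Λ : H) (hΛ0 : Λ ≠ 0) [FiniteDimensional k H]
    (hint : ∀ h : H, h * Λ = Coalgebra.counit (R := k) h • Λ) :
    ∃ l : H →ₗ[k] k,
      TensorProduct.rid k H ((l ∘ₗ antipode k).lTensor H (comul (R := k) Λ)) = 1 := by
  let F : (H →ₗ[k] k) →ₗ[k] H := (TensorProduct.rid k H).toLinearMap ∘ₗ
    (LinearMap.applyₗ (comul (R := k) Λ)) ∘ₗ (LinearMap.lTensorHom H) ∘ₗ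
    (LinearMap.lcomp k k (antipode k))
  have hF : ∀ l, F l = TensorProduct.rid k H ((l ∘ₗ antipode k).lTensor H (comul (R := k) Λ)) :=
    fun l => rfl
  have hinj : Function.Injective F := by
    rw [injective_iff_map_eq_zero]
    intro l hl
    exact inj Λ hΛ0 hint l hl
  have hs : Function.Surjective F :=
    (LinearMap.injective_iff_surjective_of_finrank_eq_finrank
      (Subspace.dual_finrank_eq)).1 hinj
  exact hs 1

end Aux7

open Aux7 Coalgebra HopfAlgebra in
theorem stmt7 {k H : Type u} [Field k] [Ring H] [HopfAlgebra k H] [FiniteDimensional k H]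
    (Λ : H) (hΛ0 : Λ ≠ 0)
    (hint : ∀ h : H, h * Λ = Coalgebra.counit (R := k) h • Λ)
    (V M : Type u) [AddCommGroup V] [Module H V] [Module k V] [IsScalarTower k H V]
    [Module.Finite H V]
    [AddCommGroup M] [Module H M] [Module k M] [IsScalarTower k H M]
    (g : V →ₗ[H] M) :
    (∃ (P : Type u) (_ : AddCommGroup P) (_ : Module H P),
      Module.Projective H P ∧ ∃ (α : V →ₗ[H] P) (β : P →ₗ[H] M), g = β.comp α) ↔
    (∃ (f : V →ₗ[k] M) (n : ℕ) (x y : Fin n → H),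
      Coalgebra.comul (R := k) Λ = ∑ i, x i ⊗ₜ[k] y i ∧
      ∀ v : V, g v = ∑ i, x i • f (HopfAlgebra.antipode (R := k) (y i) • v)) := by
  constructor
  · rintro ⟨P, _, _, hP, α, β, rfl⟩
    obtain ⟨l, hl⟩ := exists_one Λ hΛ0 hint
    obtain ⟨n, x, y, hxy⟩ : ∃ (n : ℕ) (x y : Fin n → H),
        comul (R := k) Λ = ∑ i, x i ⊗ₜ[k] y i := by
      obtain ⟨s, hs⟩ := TensorProduct.exists_finset (comul (R := k) Λ)
      refine ⟨s.card, fun i => (s.equivFin.symm i).1.1, fun i => (s.equivFin.symm i).1.2, ?_⟩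
      rw [hs, ← Finset.sum_coe_sort]
      exact (Equiv.sum_comp s.equivFin.symm (fun i => i.1.1 ⊗ₜ[k] i.1.2)).symm
    have hcas : ∀ h : H, ∑ i, l (antipode k (y i) * h) • x i = h := by
      intro h
      have e1 := congrArg (fun t => TensorProduct.rid k H (l.lTensor H t)) (casimir Λ hint h)
      have hl' := hl
      rw [hxy] at e1 hl'
      simp [Finset.mul_sum, Finset.sum_mul] at e1 hl'
      rw [← e1]
      simp only [← mul_smul_comm, ← Finset.mul_sum, hl', mul_one]
    let : Module k P := Module.compHom P (algebraMap k H)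
    have : IsScalarTower k H P := ⟨fun a b p => by
      change (a • b) • p = (algebraMap k H a) • b • p
      rw [Algebra.smul_def, mul_smul]⟩
    obtain ⟨s, hs⟩ := hP.out
    let toK {A B : Type u} [AddCommGroup A] [AddCommGroup B] [Module H A] [Module H B]
      [Module k A] [Module k B] [IsScalarTower k H A] [IsScalarTower k H B] (q : A →ₗ[H] B) :
      A →ₗ[k] B := q.restrictScalars k
    let f₀ : (P →₀ H) →ₗ[k] P :=
      Finsupp.lsum k fun p : P => l.smulRight p
    have hf₀ : ∀ w : P →₀ H, ∑ i, x i • f₀ (antipode k (y i) • w) =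
        Finsupp.linearCombination H id w := by
      intro w
      induction w using Finsupp.induction_linear with
      | zero => simp
      | add a b ha hb => simp only [smul_add, map_add, Finset.sum_add_distrib, ha, hb]
      | single p h =>
        have hb : ∀ i, f₀ (antipode k (y i) • Finsupp.single p h) =
            l (antipode k (y i) * h) • p := by
          intro i
          rw [Finsupp.smul_single, smul_eq_mul]
          simp [f₀, -Finsupp.single_mul]
        simp only [hb, Finsupp.linearCombination_single, id]
        conv_rhs => rw [← hcas h]
        rw [Finset.sum_smul]
        refine Finset.sum_congr rfl fun i _ => ?_
        rw [smul_assoc, ← algebraMap_smul H, ← algebraMap_smul H, smul_smul, smul_smul,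
          Algebra.commutes]
    refine ⟨toK β ∘ₗ f₀ ∘ₗ toK s ∘ₗ toK α, n, x, y, hxy, fun v => ?_⟩
    simp only [toK, LinearMap.comp_apply, LinearMap.restrictScalars_apply, map_smul]
    simp only [← map_smul β, ← map_sum, hf₀]
    rw [hs]
  · rintro ⟨f, n, x, y, hxy, hg⟩
    let a₀ : V →ₗ[H] H ⊗[k] M :=
      { toFun := fun v => ∑ i, x i ⊗ₜ[k] f (antipode k (y i) • v)
        map_add' := by intro u v; simp [tmul_add, Finset.sum_add_distrib]
        map_smul' := by
          intro h v
          have e1 := congrArg (fun t => (f ∘ₗ (LinearMap.toSpanSingleton H V v).restrictScalars k).lTensor H t) (casimir Λ hint h)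
          rw [hxy] at e1
          simp [Finset.mul_sum, Finset.sum_mul] at e1
          simp [Finset.smul_sum, smul_tmul', smul_smul, e1] }
    let b₀ : H ⊗[k] M →ₗ[H] M :=
      TensorProduct.AlgebraTensorModule.lift
        (LinearMap.flip
          { toFun := fun m => LinearMap.toSpanSingleton H M m
            map_add' := by intro a b; ext; simp
            map_smul' := by intro a b; ext; simp } )
    refine ⟨H ⊗[k] M, inferInstance, inferInstance, inferInstance, a₀, b₀, ?_⟩
    ext v
    simp [a₀, b₀, hg]
end

section
/- Let H be a finite-dimensional Hopf algebra over a field k with counit ε and a nonzero left integral Λ ∈ H, and let M be a left H-module. Let m ∈ M^H, i.e., h·m = ε(h)·m for all h ∈ H, and let g : k_ε → M be the H-module map sending 1 to m, where k_ε is the trivial H-module k with H acting through ε. Then g factors through a projective H-module if and only if m ∈ Λ·M, i.e., m = Λ·m′ for some m′ ∈ M. Consequently Hom_H(k_ε, M)/PHom_H(k_ε, M) ≅ M^H/Λ·M as k-vector spaces. -/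
universe u

/-- The trivial module `k_ε` of a bialgebra `H` over `k`: the field `k` with `h` acting as
multiplication by `ε(h)`. -/
def TrivMod (k H : Type u) [CommSemiring k] [Semiring H] [Bialgebra k H] : Type u := k

instance (k H : Type u) [Field k] [Ring H] [Bialgebra k H] :
    AddCommGroup (TrivMod k H) := inferInstanceAs (AddCommGroup k)

instance (k H : Type u) [Field k] [Ring H] [Bialgebra k H] :
    One (TrivMod k H) := inferInstanceAs (One k)

noncomputable instance (k H : Type u) [Field k] [Ring H] [Bialgebra k H] :
    Module H (TrivMod k H) :=
  Module.compHom k (Bialgebra.counitAlgHom k H).toRingHom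

/-- The `k`-subspace of invariants `M^H = {m : ∀ h, h • m = ε(h) • m}` of an `H`-module. -/
def invariants (k H : Type u) [Field k] [Ring H] [Bialgebra k H]
    (M : Type u) [AddCommGroup M] [Module H M] [Module k M] [SMulCommClass H k M] :
    Submodule k M where
  carrier := {m | ∀ h : H, h • m = Coalgebra.counit (R := k) h • m}
  zero_mem' := fun h => by simp
  add_mem' := by
    intro a b ha hb h
    rw [smul_add, ha h, hb h, smul_add]
  smul_mem' := by
    intro c m hm h
    rw [smul_comm h c m, hm h, smul_comm]

/-- Left multiplication by `Λ ∈ H` on an `H`-module `M`, as a `k`-linear map. -/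
def lambdaSmul (k H : Type u) [Field k] [Ring H] [Bialgebra k H]
    (M : Type u) [AddCommGroup M] [Module H M] [Module k M] [SMulCommClass H k M]
    (Λ : H) : M →ₗ[k] M where
  toFun m := Λ • m
  map_add' := smul_add Λ
  map_smul' c m := by simpa using smul_comm Λ c m

namespace HopfInt
open TensorProduct Coalgebra

variable {k H : Type u} [Field k] [Ring H] [HopfAlgebra k H]

/-- `g ⇀ h = g(h₁) h₂`. -/
noncomputable def act : Module.Dual k H →ₗ[k] H →ₗ[k] H :=
  LinearMap.mk₂ k (fun g h => TensorProduct.lid k H (LinearMap.rTensor H g (comul (R := k) h)))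
    (by intros; simp [LinearMap.rTensor_add]) (by intros; simp [LinearMap.rTensor_smul])
    (by intros; simp) (by intros; simp)

lemma act_apply (g : Module.Dual k H) (h : H) :
    act g h = TensorProduct.lid k H (LinearMap.rTensor H g (comul (R := k) h)) := rfl

lemma act_act (f g : Module.Dual k H) (h : H) :
    act g (act f h) = act (g ∘ₗ act f) h := by
  have key : ∀ z : H ⊗[k] H,
      TensorProduct.lid k H (LinearMap.rTensor H g (comul (R := k)
        (TensorProduct.lid k H (LinearMap.rTensor H f z)))) =
      TensorProduct.lid k H (LinearMap.rTensor H g (TensorProduct.lid k (H ⊗[k] H)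
        (LinearMap.rTensor (H ⊗[k] H) f (LinearMap.lTensor H (comul (R := k)) z)))) := by
    intro z
    induction z with
    | zero => simp
    | add x y hx hy => simp only [map_add, hx, hy]
    | tmul x y => simp
  have key2 : ∀ w : (H ⊗[k] H) ⊗[k] H,
      (LinearMap.rTensor H g (TensorProduct.lid k (H ⊗[k] H)
        (LinearMap.rTensor (H ⊗[k] H) f (TensorProduct.assoc k H H H w)))) =
      LinearMap.rTensor H (g ∘ₗ (TensorProduct.lid k H).toLinearMap ∘ₗ LinearMap.rTensor H f) w := by
    intro w
    induction w with
    | zero => simp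
    | add x y hx hy => simp only [map_add, hx, hy]
    | tmul x y =>
      induction x with
      | zero => simp
      | add x y hx hy => simp only [map_add, hx, hy, TensorProduct.add_tmul]
      | tmul x z => simp [TensorProduct.smul_tmul']
  rw [act_apply, act_apply, key, ← Coalgebra.coassoc_apply, key2, act_apply,
    ← LinearMap.comp_apply, ← LinearMap.rTensor_comp]
  rfl

/-- `(S(h₁) ⊗ 1) Δ(h₂) = 1 ⊗ h`. -/
lemma aux1 (h : H) (w : H ⊗[k] H) :
    TensorProduct.lift ((LinearMap.mul k (H ⊗[k] H)).compl₁₂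
      ((TensorProduct.mk k H H).flip 1 ∘ₗ HopfAlgebra.antipode k)
      ((LinearMap.mul k (H ⊗[k] H)).flip w ∘ₗ comul)) (comul h) = ((1 : H) ⊗ₜ[k] h) * w := by
  set Φ : H ⊗[k] (H ⊗[k] H) →ₗ[k] H ⊗[k] H :=
    LinearMap.rTensor H (LinearMap.mul' k H ∘ₗ LinearMap.rTensor H (HopfAlgebra.antipode k)) ∘ₗ
      (TensorProduct.assoc k H H H).symm.toLinearMap with hΦ
  have e0 : ∀ (a : H) (y : H ⊗[k] H), (HopfAlgebra.antipode k a ⊗ₜ[k] (1 : H)) * y =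
      Φ (a ⊗ₜ y) := by
    intro a y
    induction y with
    | zero => simp
    | add x y hx hy => simp only [map_add, hx, hy, mul_add, TensorProduct.tmul_add]
    | tmul x y => simp [hΦ]
  have e1 : ∀ z : H ⊗[k] H, TensorProduct.lift ((LinearMap.mul k (H ⊗[k] H)).compl₁₂
      ((TensorProduct.mk k H H).flip 1 ∘ₗ HopfAlgebra.antipode k)
      ((LinearMap.mul k (H ⊗[k] H)).flip w ∘ₗ comul)) z =
      Φ (LinearMap.lTensor H (comul (R := k)) z) * w := by
    intro z
    induction z with
    | zero => simp
    | add x y hx hy => simp only [map_add, hx, hy, add_mul]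
    | tmul x y => simp [← e0, mul_assoc]
  rw [e1, ← Coalgebra.coassoc_apply]
  congr 1
  simp only [hΦ, LinearMap.comp_apply, LinearEquiv.coe_coe, LinearEquiv.symm_apply_apply]
  rw [← LinearMap.comp_apply, ← LinearMap.rTensor_comp, LinearMap.comp_assoc,
    HopfAlgebra.mul_antipode_rTensor_comul, LinearMap.rTensor_comp, LinearMap.comp_apply,
    Coalgebra.rTensor_counit_comul]
  simp

lemma aux2 {Λ : H} (hint : ∀ h : H, h * Λ = counit (R := k) h • Λ) (h : H) :
    ((1 : H) ⊗ₜ[k] h) * comul (R := k) Λ =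
      (HopfAlgebra.antipode k h ⊗ₜ[k] (1 : H)) * comul (R := k) Λ := by
  rw [← aux1]
  have e1 : ∀ z : H ⊗[k] H, TensorProduct.lift ((LinearMap.mul k (H ⊗[k] H)).compl₁₂
      ((TensorProduct.mk k H H).flip 1 ∘ₗ HopfAlgebra.antipode k)
      ((LinearMap.mul k (H ⊗[k] H)).flip (comul (R := k) Λ) ∘ₗ comul)) z =
      (HopfAlgebra.antipode k (TensorProduct.rid k H (LinearMap.lTensor H (counit (R := k)) z))
        ⊗ₜ[k] (1 : H)) * comul (R := k) Λ := by
    intro z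
    induction z with
    | zero => simp
    | add x y hx hy => simp only [map_add, hx, hy, add_mul, TensorProduct.add_tmul]
    | tmul x y =>
      simp [← Bialgebra.comul_mul, hint, ← TensorProduct.smul_tmul']
  rw [e1, Coalgebra.lTensor_counit_comul]
  simp

lemma mul_act {Λ : H} (hint : ∀ h : H, h * Λ = counit (R := k) h • Λ) (h : H)
    (f : Module.Dual k H) :
    h * act f Λ = act (f ∘ₗ LinearMap.mulLeft k (HopfAlgebra.antipode k h)) Λ := by
  have e1 : ∀ z : H ⊗[k] H, h * TensorProduct.lid k H (LinearMap.rTensor H f z) =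
      TensorProduct.lid k H (LinearMap.rTensor H f (((1 : H) ⊗ₜ[k] h) * z)) := by
    intro z
    induction z with
    | zero => simp
    | add x y hx hy => simp only [map_add, hx, hy, mul_add]
    | tmul x y => simp
  have e2 : ∀ z : H ⊗[k] H, TensorProduct.lid k H (LinearMap.rTensor H
      (f ∘ₗ LinearMap.mulLeft k (HopfAlgebra.antipode k h)) z) =
      TensorProduct.lid k H (LinearMap.rTensor H f
        ((HopfAlgebra.antipode k h ⊗ₜ[k] (1 : H)) * z)) := by
    intro z
    induction z with
    | zero => simp
    | add x y hx hy => simp only [map_add, hx, hy, mul_add]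
    | tmul x y => simp
  rw [act_apply, e1, aux2 hint, act_apply, e2]

lemma act_counit (h : H) : act (counit (R := k)) h = h := by
  rw [act_apply, Coalgebra.rTensor_counit_comul]; simp

lemma comul_expand [FiniteDimensional k H] (h : H) :
    comul (R := k) h = ∑ i, (Module.finBasis k H i) ⊗ₜ[k]
      act ((Module.finBasis k H).coord i) h := by
  have : ∀ z : H ⊗[k] H, z = ∑ i, (Module.finBasis k H i) ⊗ₜ[k]
      TensorProduct.lid k H (LinearMap.rTensor H ((Module.finBasis k H).coord i) z) := by
    intro z
    induction z with
    | zero => simp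
    | add x y hx hy =>
      simp only [map_add, TensorProduct.tmul_add, Finset.sum_add_distrib, ← hx, ← hy]
    | tmul x y =>
      conv_lhs => rw [← (Module.finBasis k H).sum_repr x, TensorProduct.sum_tmul]
      simp [TensorProduct.smul_tmul]
  exact this _

lemma act_surj [FiniteDimensional k H] {Λ : H} (hΛ0 : Λ ≠ 0)
    (hint : ∀ h : H, h * Λ = counit (R := k) h • Λ) :
    Function.Surjective (fun f : Module.Dual k H => act f Λ) := by
  have hJ : ∃ f : Module.Dual k H, counit (R := k) (act f Λ) ≠ 0 := by
    by_contra! hc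
    apply hΛ0
    have := Coalgebra.lTensor_counit_comul (R := k) Λ
    rw [comul_expand] at this
    simp only [map_sum, LinearMap.lTensor_tmul, hc, TensorProduct.tmul_zero,
      Finset.sum_const_zero] at this
    simpa using (congrArg (TensorProduct.rid k H) this).symm
  obtain ⟨f, hf⟩ := hJ
  set J : Submodule k H := LinearMap.range ((act (k := k) (H := H)).flip Λ) with hJdef
  have hl : ∀ h x : H, x ∈ J → h * x ∈ J := by
    rintro h _ ⟨f, rfl⟩
    exact ⟨_, (mul_act hint h f).symm⟩
  have hc : ∀ (g : Module.Dual k H) (x : H), x ∈ J → act g x ∈ J := by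
    rintro g _ ⟨f, rfl⟩
    exact ⟨_, (act_act f g Λ).symm⟩
  have h1 : algebraMap k H (counit (R := k) (act f Λ)) ∈ J := by
    rw [← HopfAlgebra.mul_antipode_rTensor_comul_apply, comul_expand]
    simp only [map_sum, LinearMap.rTensor_tmul, LinearMap.mul'_apply]
    exact Submodule.sum_mem _ fun i _ => hl _ _ (hc _ _ ⟨f, rfl⟩)
  have h2 : (1 : H) ∈ J := by
    have := J.smul_mem (counit (R := k) (act f Λ))⁻¹ h1
    rwa [Algebra.algebraMap_eq_smul_one, smul_smul, inv_mul_cancel₀ hf, one_smul] at this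
  intro x
  obtain ⟨f, hf⟩ := hl x 1 h2
  exact ⟨f, by simpa using hf⟩

theorem unique [FiniteDimensional k H] {Λ : H} (hΛ0 : Λ ≠ 0)
    (hint : ∀ h : H, h * Λ = counit (R := k) h • Λ) (t : H)
    (ht : ∀ h : H, h * t = counit (R := k) h • t) : ∃ c : k, t = c • Λ := by
  have hs := act_surj hΛ0 hint
  have hinj : Function.Injective ((act (k := k) (H := H)).flip Λ) :=
    (LinearMap.injective_iff_surjective_of_finrank_eq_finrank
      (Subspace.dual_finrank_eq)).2 hs
  have hSinj : Function.Injective (HopfAlgebra.antipode k (A := H)) := by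
    rw [injective_iff_map_eq_zero]
    intro h hh
    obtain ⟨l, hl⟩ := hs 1
    have := mul_act hint h l
    simp only at hl
    rw [hl, hh, mul_one] at this
    simpa using this
  have hSsurj := LinearMap.injective_iff_surjective.1 hSinj
  have key : ∀ (t : H), (∀ h : H, h * t = counit (R := k) h • t) → ∀ f : Module.Dual k H,
      act f Λ = t → ∀ h, f (HopfAlgebra.antipode k h) = counit (R := k) h * f 1 := by
    intro t ht f hf h
    have := mul_act hint h f
    rw [hf, ht, ← hf] at this
    have h2 : counit (R := k) h • f = f ∘ₗ LinearMap.mulLeft k (HopfAlgebra.antipode k h) :=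
      hinj (by simpa using this)
    simpa using (LinearMap.congr_fun h2 1).symm
  obtain ⟨f, hf⟩ := hs t
  refine ⟨f 1, ?_⟩
  have k1 := key t ht f hf
  have k2 := key Λ hint (counit (R := k)) (act_counit Λ)
  have : f = f 1 • (counit (R := k) : Module.Dual k H) := by
    ext x
    obtain ⟨h, rfl⟩ := hSsurj x
    rw [LinearMap.smul_apply, k1, k2]
    simp [mul_comm]
  simp only at hf
  rw [← hf]
  conv_lhs => rw [this]
  rw [map_smul, LinearMap.smul_apply, act_counit]

lemma smul_one_triv (h : H) :
    h • (1 : TrivMod k H) = algebraMap k H (counit (R := k) h) • (1 : TrivMod k H) := by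
  change counit (R := k) h • (1 : k) = counit (R := k) (algebraMap k H (counit (R := k) h)) • (1 : k)
  simp

lemma triv_eq (c : TrivMod k H) : c = algebraMap k H c • (1 : TrivMod k H) := by
  have h : ∀ c : k, c = counit (R := k) (algebraMap k H c) • (1 : k) := by
    intro c
    simp
  exact h c

/-- the map `k_ε → M` with `1 ↦ m`. -/
noncomputable def ofInv {M : Type u} [AddCommGroup M] [Module H M] [Module k M]
    [IsScalarTower k H M] (m : M) (hm : ∀ h : H, h • m = counit (R := k) h • m) :
    TrivMod k H →ₗ[H] M where
  toFun c := (show k from c) • m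
  map_add' a b := add_smul (R := k) a b m
  map_smul' h c := by
    have key : ∀ c : k, (counit (R := k) h * c) • m = h • c • m := by
      intro c
      rw [← algebraMap_smul H c m, smul_smul h, hm, Bialgebra.counit_mul,
        Bialgebra.counit_algebraMap]
    exact key c

lemma ofInv_one {M : Type u} [AddCommGroup M] [Module H M] [Module k M]
    [IsScalarTower k H M] (m : M) (hm : ∀ h : H, h • m = counit (R := k) h • m) :
    ofInv m hm 1 = m := one_smul k m

lemma hom_ext {M : Type u} [AddCommGroup M] [Module H M] {f g : TrivMod k H →ₗ[H] M}
    (h : f 1 = g 1) : f = g := by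
  ext c
  rw [triv_eq c, map_smul, map_smul, h]

lemma hom_inv {M : Type u} [AddCommGroup M] [Module H M] [Module k M]
    [IsScalarTower k H M] (f : TrivMod k H →ₗ[H] M) (h : H) :
    h • f 1 = counit (R := k) h • f 1 := by
  rw [← map_smul, smul_one_triv, map_smul, algebraMap_smul]

lemma main [FiniteDimensional k H]
    (Λ : H) (hΛ0 : Λ ≠ 0)
    (hint : ∀ h : H, h * Λ = Coalgebra.counit (R := k) h • Λ)
    (M : Type u) [AddCommGroup M] [Module H M] [Module k M] [IsScalarTower k H M]
    (g : TrivMod k H →ₗ[H] M) :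
      ((∃ (P : Type u) (_ : AddCommGroup P) (_ : Module H P),
          Module.Projective H P ∧
          ∃ (α : TrivMod k H →ₗ[H] P) (β : P →ₗ[H] M), g = β.comp α) ↔
        ∃ m' : M, g 1 = Λ • m') := by
  constructor
  · rintro ⟨P, _, _, hP, α, β, rfl⟩
    obtain ⟨s, hs⟩ := hP.out
    have hc : ∀ x, ∃ c : k, s (α 1) x = c • Λ := by
      intro x
      refine unique hΛ0 hint _ fun h => ?_
      have := congrArg (fun z => s (α z) x) (smul_one_triv (k := k) h)
      simpa [Algebra.smul_def] using this
    choose c hc using hc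
    refine ⟨β ((s (α 1)).sum fun x _ => algebraMap k H (c x) • x), ?_⟩
    rw [← map_smul, LinearMap.comp_apply]
    congr 1
    conv_lhs => rw [← hs (α 1)]
    rw [Finsupp.linearCombination_apply, Finsupp.sum, Finsupp.sum, Finset.smul_sum]
    refine Finset.sum_congr rfl fun x _ => ?_
    rw [hc, smul_smul, ← Algebra.commutes, Algebra.smul_def]
    rfl
  · rintro ⟨m', hm'⟩
    refine ⟨H, inferInstance, inferInstance, inferInstance, ofInv Λ hint,
      LinearMap.toSpanSingleton H M m', hom_ext ?_⟩
    rw [LinearMap.comp_apply, ofInv_one, hm']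
    rfl

end HopfInt

/-- Let H be a finite-dimensional Hopf algebra over a field k with counit ε and
nonzero left integral Λ, M a left H-module, m ∈ M^H, and g : k_ε → M the H-module map with
g(1) = m. Then g factors through a projective H-module iff m ∈ Λ·M. Consequently
Hom_H(k_ε, M)/PHom_H(k_ε, M) ≅ M^H/Λ·M as k-vector spaces. -/
theorem stmt8 {k H : Type u} [Field k] [Ring H] [HopfAlgebra k H] [FiniteDimensional k H]
    (Λ : H) (hΛ0 : Λ ≠ 0)
    (hint : ∀ h : H, h * Λ = Coalgebra.counit (R := k) h • Λ)
    (M : Type u) [AddCommGroup M] [Module H M] [Module k M] [IsScalarTower k H M]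
    [SMulCommClass H k M]
    (m : M) (hm : ∀ h : H, h • m = Coalgebra.counit (R := k) h • m) :
    (∀ g : TrivMod k H →ₗ[H] M, g 1 = m →
      ((∃ (P : Type u) (_ : AddCommGroup P) (_ : Module H P),
          Module.Projective H P ∧
          ∃ (α : TrivMod k H →ₗ[H] P) (β : P →ₗ[H] M), g = β.comp α) ↔
        ∃ m' : M, m = Λ • m')) ∧
    Nonempty
      (((TrivMod k H →ₗ[H] M) ⧸ PHom k H (TrivMod k H) M) ≃ₗ[k]
        (↥(invariants k H M) ⧸
          Submodule.comap (invariants k H M).subtype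
            (LinearMap.range (lambdaSmul k H M Λ)))) := by
  refine ⟨fun g hg => ?_, ?_⟩
  · subst hg
    exact HopfInt.main Λ hΛ0 hint M g
  · let e : (TrivMod k H →ₗ[H] M) ≃ₗ[k] invariants k H M :=
      { toFun := fun f => ⟨f 1, HopfInt.hom_inv f⟩
        map_add' := fun f g => rfl
        map_smul' := fun c f => rfl
        invFun := fun x => HopfInt.ofInv x.1 x.2
        left_inv := fun f => HopfInt.hom_ext (HopfInt.ofInv_one _ _)
        right_inv := fun x => Subtype.ext (HopfInt.ofInv_one _ _) }
    refine ⟨Submodule.Quotient.equiv _ _ e ?_⟩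
    ext x
    obtain ⟨f, rfl⟩ := e.surjective x
    have h1 : e f ∈ Submodule.map (e : (TrivMod k H →ₗ[H] M) →ₗ[k] invariants k H M)
        (PHom k H (TrivMod k H) M) ↔ f ∈ PHom k H (TrivMod k H) M := by
      constructor
      · rintro ⟨f', hf', h⟩
        rwa [← e.injective h]
      · exact fun h => ⟨f, h, rfl⟩
    refine h1.trans ((HopfInt.main Λ hΛ0 hint M f).trans ?_)
    exact ⟨fun ⟨m', h⟩ => ⟨m', h.symm⟩, fun ⟨m', h⟩ => ⟨m', h.symm⟩⟩
end

section
/- Let H be a finite-dimensional Hopf algebra over a field k with antipode S, comultiplication Δ (written Δ(h) = Σ h₁ ⊗ h₂) and nonzero left integral Λ ∈ H. Let V be a finitely generated left H-module and M any left H-module, and let ind(M) = H ⊗_k M be the free H-module with H acting on the left tensor factor. Then the map f ↦ f̃, where f̃(v) = Σ Λ₁ ⊗ f(S(Λ₂)·v), is a k-linear bijection from Hom_k(V, M) onto Hom_H(V, ind(M)). -/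
universe u

open TensorProduct

section helpers
variable {k H : Type*} [Field k] [Ring H] [HopfAlgebra k H]
open Coalgebra HopfAlgebra

noncomputable def auxF (n : ℕ) (x y : Fin n → H) : (H ⊗[k] H) ⊗[k] H →ₗ[k] H ⊗[k] H :=
  ∑ i, (LinearMap.lTensor H (LinearMap.mul' k H)) ∘ₗ
    (TensorProduct.assoc k H H H).toLinearMap ∘ₗ
    LinearMap.rTensor H (TensorProduct.map (LinearMap.mulRight k (x i))
      (antipode k ∘ₗ LinearMap.mulRight k (y i)))

lemma auxF_tmul (n : ℕ) (x y : Fin n → H) (a b c : H) :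
    auxF (k := k) n x y ((a ⊗ₜ b) ⊗ₜ c) =
      ∑ i, (a * x i) ⊗ₜ[k] (antipode k (b * y i) * c) := by
  simp [auxF, LinearMap.sum_apply]

lemma auxF_left (n : ℕ) (x y : Fin n → H) (Λ : H)
    (hrep : comul (R := k) Λ = ∑ i, x i ⊗ₜ[k] y i) (a c : H) :
    auxF n x y (comul (R := k) a ⊗ₜ c) =
      LinearMap.lTensor H (LinearMap.mulRight k c ∘ₗ antipode k) (comul (R := k) (a * Λ)) := by
  rw [Bialgebra.comul_mul, hrep]
  generalize comul (R := k) a = t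
  induction t with
  | zero => simp
  | add s t hs ht => rw [TensorProduct.add_tmul, map_add, hs, ht, add_mul, map_add]
  | tmul p q => simp [auxF_tmul, Finset.mul_sum]

lemma auxF_right (n : ℕ) (x y : Fin n → H) (a : H) (t : H ⊗[k] H) :
    auxF n x y ((TensorProduct.assoc k H H H).symm (a ⊗ₜ t)) =
      ∑ i, (a * x i) ⊗ₜ[k] (antipode k (y i) *
        LinearMap.mul' k H ((antipode k).rTensor H t)) := by
  induction t with
  | zero => simp
  | add s t hs ht =>
    rw [TensorProduct.tmul_add, map_add, map_add, hs, ht, ← Finset.sum_add_distrib]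
    simp [mul_add, TensorProduct.tmul_add]
  | tmul p q => simp [auxF_tmul, antipode_mul_antidistrib, mul_assoc]

lemma sum_counit_smul_right (h : H) {ι : Type*} (r : Repr k h ι) :
    ∑ j ∈ r.index, counit (R := k) (r.right j) • r.left j = h := by
  simpa only [map_sum, TensorProduct.lift.tmul, LinearMap.flip_apply, LinearMap.lsmul_apply,
    one_smul] using congr(TensorProduct.lift (LinearMap.lsmul k H).flip $(sum_tmul_counit_eq (R := k) r))

lemma casimir (n : ℕ) (x y : Fin n → H) (Λ : H)
    (hint : ∀ h : H, h * Λ = counit (R := k) h • Λ)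
    (hrep : comul (R := k) Λ = ∑ i, x i ⊗ₜ[k] y i) (h : H) :
    ∑ i, (h * x i) ⊗ₜ[k] antipode k (y i) = ∑ i, x i ⊗ₜ[k] (antipode k (y i) * h) := by
  let r := ℛ k h
  have h1 : auxF n x y ((comul (R := k)).rTensor H (comul (R := k) h)) =
      ∑ i, x i ⊗ₜ[k] (antipode k (y i) * h) := by
    conv_rhs => rw [← sum_counit_smul r]
    rw [← r.eq]
    simp only [map_sum, LinearMap.rTensor_tmul, auxF_left n x y Λ hrep, hint, map_smul, hrep]
    simp [Finset.smul_sum, Finset.mul_sum, TensorProduct.tmul_sum]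
    rw [Finset.sum_comm]
  have h2 : auxF n x y ((TensorProduct.assoc k H H H).symm
      ((comul (R := k)).lTensor H (comul (R := k) h))) =
      ∑ i, (h * x i) ⊗ₜ[k] antipode k (y i) := by
    conv_rhs => rw [← sum_counit_smul_right h r]
    rw [← r.eq]
    simp only [map_sum, LinearMap.lTensor_tmul, auxF_right, mul_antipode_rTensor_comul_apply]
    rw [Finset.sum_comm]
    simp [Finset.sum_mul, TensorProduct.sum_tmul, Algebra.algebraMap_eq_smul_one,
      TensorProduct.smul_tmul']
  rw [← h1, ← h2, coassoc_symm_apply]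

lemma exists_frob [FiniteDimensional k H] (n : ℕ) (x y : Fin n → H) (Λ : H) (hΛ0 : Λ ≠ 0)
    (hint : ∀ h : H, h * Λ = counit (R := k) h • Λ)
    (hrep : comul (R := k) Λ = ∑ i, x i ⊗ₜ[k] y i) :
    ∃ l : H →ₗ[k] k, ∑ i, l (x i) • antipode k (y i) = 1 := by
  obtain ⟨m, hm⟩ := Module.Projective.exists_dual_eq_one k hΛ0
  let b := Module.finBasis k H
  let ψ : Fin (Module.finrank k H) → (H →ₗ[k] k) := fun j =>
    LinearMap.mul' k k ∘ₗ TensorProduct.map m (b.coord j) ∘ₗ comul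
  let Q : H ⊗[k] H →ₗ[k] H := TensorProduct.lift (LinearMap.lsmul k H ∘ₗ m)
  have hQt : ∀ t : H ⊗[k] H,
      ∑ j, (LinearMap.mul' k k (TensorProduct.map m (b.coord j) t)) • b j = Q t := by
    intro t
    induction t with
    | zero => simp
    | add s t hs ht => simp only [map_add, add_smul, Finset.sum_add_distrib, hs, ht]
    | tmul p q =>
      simp only [TensorProduct.map_tmul, LinearMap.mul'_apply, mul_smul, ← Finset.smul_sum]
      simp [Q, b.sum_repr]
  have hQ : ∀ a : H, ∑ j, ψ j a • b j = Q (comul a) := fun a => hQt _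
  let G : (H ⊗[k] H) ⊗[k] H →ₗ[k] H :=
    LinearMap.mul' k H ∘ₗ LinearMap.rTensor H (antipode k ∘ₗ Q)
  have hG : ∀ (a : H) (t : H ⊗[k] H), G ((TensorProduct.assoc k H H H).symm (a ⊗ₜ t)) =
      m a • LinearMap.mul' k H ((antipode k).rTensor H t) := by
    intro a t
    induction t with
    | zero => simp
    | add s t hs ht => rw [TensorProduct.tmul_add, map_add, map_add, hs, ht]; simp
    | tmul p q => simp [G, Q]
  have hx : ∑ i, counit (R := k) (y i) • x i = Λ := by
    have := congr(TensorProduct.lift (LinearMap.lsmul k H).flip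
      $(lTensor_counit_comul (R := k) Λ))
    rw [hrep] at this
    simpa using this
  have key : ∑ i, antipode k (Q (comul (x i))) * y i = 1 := by
    have e := congr(G $(coassoc_symm_apply (R := k) Λ))
    rw [hrep] at e
    simp only [map_sum, LinearMap.lTensor_tmul, LinearMap.rTensor_tmul, hG,
      mul_antipode_rTensor_comul_apply] at e
    have e2 : ∑ i, antipode k (Q (comul (x i))) * y i = ∑ i, G (comul (R := k) (x i) ⊗ₜ[k] y i) := by
      simp [G]
    rw [e2, ← e]
    have e3 : m Λ • (1 : H) = 1 := by rw [hm, one_smul]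
    rw [← e3, ← hx]
    simp [Algebra.algebraMap_eq_smul_one, Finset.sum_smul, smul_smul, mul_comm]
  refine ⟨∑ j, ψ j ∘ₗ LinearMap.mulLeft k (antipode k (antipode k (b j))), ?_⟩
  have c : ∀ j h, ∑ i, ψ j (h * x i) • antipode k (y i) =
      ∑ i, ψ j (x i) • (antipode k (y i) * h) := by
    intro j h
    simpa using congr(TensorProduct.lift (LinearMap.lsmul k H ∘ₗ ψ j)
      $(casimir n x y Λ hint hrep h))
  simp only [LinearMap.sum_apply, LinearMap.comp_apply, LinearMap.mulLeft_apply, Finset.sum_smul]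
  rw [Finset.sum_comm]
  simp only [c]
  rw [Finset.sum_comm]
  have := congr(antipode k $key)
  rw [antipode_one] at this
  rw [← this]
  simp only [← hQ, map_sum, antipode_mul_antidistrib, map_smul, Finset.mul_sum, mul_smul_comm]

lemma exists_frob2 [FiniteDimensional k H] (n : ℕ) (x z : Fin n → H)
    (cas : ∀ h : H, ∑ i, (h * x i) ⊗ₜ[k] z i = ∑ i, x i ⊗ₜ[k] (z i * h))
    (l : H →ₗ[k] k) (hl : ∑ i, l (x i) • z i = 1) :
    ∑ i, l (z i) • x i = 1 := by
  let Φ : Module.Dual k H →ₗ[k] H :=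
    ∑ i, (LinearMap.toSpanSingleton k H (z i)) ∘ₗ Module.Dual.eval k H (x i)
  have hΦ : ∀ μ, Φ μ = ∑ i, μ (x i) • z i := by
    intro μ; simp [Φ, LinearMap.sum_apply]
  have hΦΨ : ∀ h, Φ (l ∘ₗ LinearMap.mulLeft k h) = h := by
    intro h
    have := congr(TensorProduct.lift (LinearMap.lsmul k H ∘ₗ l) $(cas h))
    simp at this
    rw [hΦ]
    simp only [LinearMap.comp_apply, LinearMap.mulLeft_apply]
    rw [this]
    calc _ = (∑ i, l (x i) • z i) * h := by simp [Finset.sum_mul]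
      _ = h := by rw [hl, one_mul]
  have inj : Function.Injective Φ :=
    (LinearMap.injective_iff_surjective_of_finrank_eq_finrank
      (Subspace.dual_finrank_eq)).2 fun h => ⟨_, hΦΨ h⟩
  rw [← sub_eq_zero, ← Module.forall_dual_apply_eq_zero_iff k]
  intro μ
  have e : l ∘ₗ LinearMap.mulLeft k (Φ μ) = μ := inj (hΦΨ _)
  have e1 := congr($e 1)
  rw [hΦ] at e1
  simp at e1
  rw [map_sub, ← e1, sub_eq_zero]
  simp [mul_comm]

end helpers

/-- Let H be a finite-dimensional Hopf algebra over a field k with antipode S,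
comultiplication Δ and nonzero left integral Λ, let V be a finitely generated left H-module,
M any left H-module, and ind(M) = H ⊗ₖ M the free H-module with H acting on the left tensor
factor. Then f ↦ f̃, where f̃(v) = Σ Λ₁ ⊗ f(S(Λ₂)·v), is a k-linear bijection from
Hom_k(V, M) onto Hom_H(V, ind(M)). Here Δ(Λ) = Σᵢ xᵢ ⊗ yᵢ is a finite representation of the
comultiplication of Λ; the bijectivity of f ↦ f̃ is expressed by: (1) for each k-linear
f : V → M the formula defines an H-linear map V → H ⊗ₖ M (well-definedness, and hence f ↦ f̃
is a map into Hom_H(V, ind M), clearly additive and k-homogeneous in f), and (2) every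
H-linear g : V → H ⊗ₖ M arises from a *unique* f (bijectivity). -/
theorem stmt9 {k H : Type u} [Field k] [Ring H] [HopfAlgebra k H] [FiniteDimensional k H]
    (Λ : H) (hΛ0 : Λ ≠ 0)
    (hint : ∀ h : H, h * Λ = Coalgebra.counit (R := k) h • Λ)
    (V M : Type u) [AddCommGroup V] [Module H V] [Module k V] [IsScalarTower k H V]
    [Module.Finite H V]
    [AddCommGroup M] [Module H M] [Module k M] [IsScalarTower k H M]
    (n : ℕ) (x y : Fin n → H)
    (hrep : Coalgebra.comul (R := k) Λ = ∑ i, x i ⊗ₜ[k] y i) :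
    (∀ f : V →ₗ[k] M, ∃ g : V →ₗ[H] (H ⊗[k] M),
      ∀ v : V, g v = ∑ i, x i ⊗ₜ[k] f (HopfAlgebra.antipode (R := k) (y i) • v)) ∧
    (∀ g : V →ₗ[H] (H ⊗[k] M), ∃! f : V →ₗ[k] M,
      ∀ v : V, g v = ∑ i, x i ⊗ₜ[k] f (HopfAlgebra.antipode (R := k) (y i) • v)) := by
  have cas := casimir n x y Λ hint hrep
  obtain ⟨l, hl⟩ := exists_frob n x y Λ hΛ0 hint hrep
  have hl2 := exists_frob2 n x _ cas l hl
  constructor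
  · intro f
    refine ⟨{ toFun := fun v => ∑ i, x i ⊗ₜ[k] f (HopfAlgebra.antipode (R := k) (y i) • v)
              map_add' := ?_, map_smul' := ?_ }, fun v => rfl⟩
    · intro v w
      simp [smul_add, TensorProduct.tmul_add, Finset.sum_add_distrib]
    · intro h v
      have := congr(TensorProduct.map LinearMap.id
        (f ∘ₗ (LinearMap.toSpanSingleton H V v).restrictScalars k) $(cas h))
      simp [mul_smul] at this
      simp [Finset.smul_sum, TensorProduct.smul_tmul', ← this]
  · intro g
    let L : H ⊗[k] M →ₗ[k] M := TensorProduct.lift (LinearMap.lsmul k M ∘ₗ l)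
    refine ⟨L ∘ₗ g.restrictScalars k, ?_, ?_⟩
    · intro v
      simp only [LinearMap.comp_apply, LinearMap.restrictScalars_apply, map_smul]
      generalize g v = t
      induction t with
      | zero => simp
      | add s t hs ht =>
        simp only [smul_add, map_add, TensorProduct.tmul_add, Finset.sum_add_distrib]
        rw [← hs, ← ht]
      | tmul a m =>
        have := congr(TensorProduct.lift ((LinearMap.lsmul k H).flip.compl₂ l) $(cas a))
        simp at this
        have h2 : a = ∑ i, l (HopfAlgebra.antipode k (y i) * a) • x i := by
          rw [← this]
          calc a = a * ∑ i, l (HopfAlgebra.antipode k (y i)) • x i := by rw [hl2, mul_one]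
            _ = _ := by simp [Finset.mul_sum]
        conv_lhs => rw [h2]
        simp [L, TensorProduct.smul_tmul', TensorProduct.sum_tmul, TensorProduct.tmul_smul]
    · intro f hf
      ext v
      simp only [LinearMap.comp_apply, LinearMap.restrictScalars_apply, hf]
      have := congr(f ($hl • v))
      simp only [Finset.sum_smul, smul_assoc, map_sum, map_smul, one_smul] at this
      simp [L, this]
end

section
/- Let k be a field, G a finite group acting by automorphisms on a group A, and Γ = A ⋊ G the semidirect product, so that the group algebra kΓ contains R = kA and H = kG as subalgebras. Let Λ = Σ_{g∈G} g ∈ kG and assume that R = kA is noetherian as a module over the invariant subalgebra R^G = (kA)^G. Then every finitely generated left kΓ-module is stably finitely generated as a kG-module (under restriction) if and only if the k-vector space (kA)^G / Λ·kA is finite-dimensional over k. -/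
universe u

/-- The action of `g : G` on the group algebra `kA`, induced by an action
`φ : G →* MulAut A` on the group `A`, as a `k`-algebra automorphism (here as an
algebra endomorphism). -/
noncomputable def gAct (k : Type u) {A G : Type u} [Field k] [Group A] [Group G]
    (φ : G →* MulAut A) (g : G) :
    MonoidAlgebra k A →ₐ[k] MonoidAlgebra k A :=
  MonoidAlgebra.mapDomainAlgHom k k (φ g)

/-- The invariant subalgebra `(kA)^G` of the group algebra `kA`. -/
def invAlg (k : Type u) {A G : Type u} [Field k] [Group A] [Group G]
    (φ : G →* MulAut A) : Subalgebra k (MonoidAlgebra k A) where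
  carrier := {r | ∀ g : G, gAct k φ g r = r}
  mul_mem' := fun {a b} ha hb g => by rw [map_mul, ha g, hb g]
  one_mem' := fun g => map_one _
  add_mem' := fun {a b} ha hb g => by rw [map_add, ha g, hb g]
  zero_mem' := fun g => map_zero _
  algebraMap_mem' := fun c g => (gAct k φ g).commutes c

/-- The orbit-sum operator `r ↦ Λ·r = Σ_{g ∈ G} g·r` on the group algebra `kA`,
i.e. the action of the integral `Λ = Σ_{g ∈ G} g` of `kG`. -/
noncomputable def orbitSum (k : Type u) {A G : Type u} [Field k] [Group A] [Group G]
    [Fintype G] (φ : G →* MulAut A) :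
    MonoidAlgebra k A →ₗ[k] MonoidAlgebra k A :=
  ∑ g : G, (gAct k φ g).toLinearMap

/-- A module over the group algebra `kΓ` of `Γ = A ⋊[φ] G` is *stably finitely generated as
a `kG`-module under restriction* if, when viewed as a `kG`-module via the inclusion
`kG → kΓ` induced by `G → Γ`, it is stably finitely generated. -/
def RestrictedStablyFG (k : Type u) {A G : Type u} [Field k] [Group A] [Group G]
    (φ : G →* MulAut A) (M : Type u) [AddCommGroup M]
    [Module (MonoidAlgebra k (A ⋊[φ] G)) M] : Prop :=
  letI : Module (MonoidAlgebra k G) M :=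
    Module.compHom M
      (MonoidAlgebra.mapDomainRingHom k (SemidirectProduct.inr : G →* A ⋊[φ] G))
  StablyFG (MonoidAlgebra k G) M

open MonoidAlgebra
section gen
set_option linter.unusedSectionVars false
variable {k : Type*} [Field k] {G : Type*} [Group G] [Fintype G]
variable {U : Type*} [AddCommGroup U] [Module k U] [Module (MonoidAlgebra k G) U] [IsScalarTower k (MonoidAlgebra k G) U]
variable {V : Type*} [AddCommGroup V] [Module k V] [Module (MonoidAlgebra k G) V] [IsScalarTower k (MonoidAlgebra k G) V]
variable {W : Type*} [AddCommGroup W] [Module k W] [Module (MonoidAlgebra k G) W] [IsScalarTower k (MonoidAlgebra k G) W]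

/-- trace -/
noncomputable abbrev Tr (f : V →ₗ[k] W) : V →ₗ[MonoidAlgebra k G] W :=
  f.sumOfConjugatesEquivariant G

lemma Tr_apply (f : V →ₗ[k] W) (v : V) :
    (Tr f : V →ₗ[MonoidAlgebra k G] W) v =
      ∑ g : G, single g⁻¹ (1 : k) • f (single g (1 : k) • v) :=
  f.sumOfConjugatesEquivariant_apply G v

lemma comp_Tr (u : V →ₗ[MonoidAlgebra k G] W) (f : U →ₗ[k] V) (x : U) :
    u ((Tr f : U →ₗ[MonoidAlgebra k G] V) x) =
      (Tr ((u.restrictScalars k) ∘ₗ f) : U →ₗ[MonoidAlgebra k G] W) x := by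
  simp [Tr_apply]

lemma Tr_comp (f : V →ₗ[k] W) (u : U →ₗ[MonoidAlgebra k G] V) (x : U) :
    (Tr f : V →ₗ[MonoidAlgebra k G] W) (u x) =
      (Tr (f ∘ₗ (u.restrictScalars k)) : U →ₗ[MonoidAlgebra k G] W) x := by
  simp [Tr_apply]

/-- coefficient at one -/
noncomputable def coeffOne (k : Type*) [Field k] (G : Type*) [Group G] :
    MonoidAlgebra k G →ₗ[k] MonoidAlgebra k G :=
  { toFun := fun x => single 1 (x.coeff 1)
    map_add' := fun x y => by simp [single_add]
    map_smul' := fun c x => by simp }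

lemma coeffOne_apply (x : MonoidAlgebra k G) : coeffOne k G x = single 1 (x.coeff 1) := rfl

lemma Tr_coeffOne (x : MonoidAlgebra k G) :
    (Tr (coeffOne k G) : _ →ₗ[MonoidAlgebra k G] _) x = x := by
  classical
  have : (Tr (coeffOne k G) : _ →ₗ[MonoidAlgebra k G] _) 1 = 1 := by
    rw [Tr_apply, Finset.sum_eq_single 1]
    · simp [coeffOne_apply, one_def]
    · intro g _ hg
      simp [coeffOne_apply, hg]
    · simp
  calc _ = (Tr (coeffOne k G) : _ →ₗ[MonoidAlgebra k G] _) (x • 1) := by simp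
    _ = _ := by rw [map_smul, this]; simp

lemma exists_theta_of_projective (hV : Module.Projective (MonoidAlgebra k G) V) :
    ∃ θ : V →ₗ[k] V, ∀ x, (Tr θ : V →ₗ[MonoidAlgebra k G] V) x = x := by
  obtain ⟨s, hs⟩ := hV.out
  let θ : (V →₀ MonoidAlgebra k G) →ₗ[k] (V →₀ MonoidAlgebra k G) :=
    Finsupp.mapRange.linearMap (coeffOne k G)
  have hθ : ∀ x, (Tr θ : _ →ₗ[MonoidAlgebra k G] _) x = x := by
    intro x
    ext1 v
    rw [Tr_apply, Finsupp.finsetSum_apply]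
    conv_rhs => rw [← Tr_coeffOne (x v), Tr_apply]
    simp [θ]
  let π := Finsupp.linearCombination (MonoidAlgebra k G) (id : V → V)
  refine ⟨(π.restrictScalars k) ∘ₗ θ ∘ₗ (s.restrictScalars k), fun x => ?_⟩
  rw [← comp_Tr, ← Tr_comp, hθ]
  exact hs x

lemma exists_extend (hV : Module.Projective (MonoidAlgebra k G) V)
    (i : U →ₗ[MonoidAlgebra k G] W) (hi : Function.Injective i)
    (j : U →ₗ[MonoidAlgebra k G] V) :
    ∃ w : W →ₗ[MonoidAlgebra k G] V, ∀ x, w (i x) = j x := by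
  obtain ⟨θ, hθ⟩ := exists_theta_of_projective (k := k) hV
  obtain ⟨l, hl⟩ := (i.restrictScalars k).exists_leftInverse_of_injective
    (LinearMap.ker_eq_bot.2 hi)
  refine ⟨Tr (θ ∘ₗ (j.restrictScalars k) ∘ₗ l), fun x => ?_⟩
  rw [Tr_comp]
  have : (θ ∘ₗ (j.restrictScalars k) ∘ₗ l) ∘ₗ (i.restrictScalars k) = 
      θ ∘ₗ (j.restrictScalars k) := by
    rw [LinearMap.comp_assoc, LinearMap.comp_assoc, hl, LinearMap.comp_id]
  rw [this, ← Tr_comp, hθ]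

open TensorProduct in
lemma exists_proj_sub [Module.Finite k U] [IsSemisimpleModule (MonoidAlgebra k G) U]
    (f : U →ₗ[k] W) (u0 : U) (hu0 : (Tr f : U →ₗ[MonoidAlgebra k G] W) u0 ≠ 0) :
    ∃ E : Submodule (MonoidAlgebra k G) W, E ≠ ⊥ ∧ Module.Projective (MonoidAlgebra k G) E := by
  obtain ⟨T, hT⟩ := exists_isCompl (LinearMap.ker (Tr f : U →ₗ[MonoidAlgebra k G] W))
  have hTne : T ≠ ⊥ := by
    rintro rfl
    have := hT.sup_eq_top
    rw [sup_bot_eq, LinearMap.ker_eq_top] at this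
    exact hu0 (by rw [this]; rfl)
  let E := MonoidAlgebra k G ⊗[k] U
  let ι : U →ₗ[MonoidAlgebra k G] E := Tr (TensorProduct.mk k (MonoidAlgebra k G) U 1)
  let F : E →ₗ[MonoidAlgebra k G] W := TensorProduct.AlgebraTensorModule.lift
    (LinearMap.toSpanSingleton (MonoidAlgebra k G) _ f)
  have hF : ∀ u, F (ι u) = (Tr f : U →ₗ[MonoidAlgebra k G] W) u := by
    intro u
    rw [comp_Tr]
    congr 2
    ext x
    change F (1 ⊗ₜ x) = f x
    exact congrArg (fun z : U →ₗ[k] W => z x) (one_smul (MonoidAlgebra k G) f)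
  have hinj : Function.Injective ((F ∘ₗ ι) ∘ₗ T.subtype) := by
    rw [← LinearMap.ker_eq_bot, eq_bot_iff]
    rintro ⟨t, ht⟩ h
    have h1 : (Tr f : U →ₗ[MonoidAlgebra k G] W) t = 0 := by
      rw [← hF]; exact h
    have h2 : t ∈ LinearMap.ker (Tr f : U →ₗ[MonoidAlgebra k G] W) ⊓ T := ⟨h1, ht⟩
    rw [hT.inf_eq_bot] at h2
    simpa using h2
  obtain ⟨w, hw⟩ := exists_extend (k := k) (G := G) (V := E) inferInstance _ hinj (ι ∘ₗ T.subtype)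
  let u : Module.End (MonoidAlgebra k G) E := w ∘ₗ F
  have hu : ∀ t ∈ T, u (ι t) = ι t := fun t ht => hw ⟨t, ht⟩
  have hun : ∀ n : ℕ, ∀ t ∈ T, (u ^ n) (ι t) = ι t := by
    intro n t ht
    induction n with
    | zero => simp
    | succ n ih => rw [pow_succ, Module.End.mul_apply, hu t ht, ih]
  have : Module.Finite k E := inferInstance
  have : IsNoetherian (MonoidAlgebra k G) E := isNoetherian_of_tower k inferInstance
  have : IsArtinian (MonoidAlgebra k G) E := isArtinian_of_tower k inferInstance
  obtain ⟨n, hn1, hn⟩ := ((Filter.eventually_ge_atTop 1).and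
    (u.eventually_isCompl_ker_pow_range_pow)).exists
  set E' := LinearMap.range (u ^ n) with hE'
  have : Module.Projective (MonoidAlgebra k G) E' :=
    Module.Projective.of_split E'.subtype (E'.projectionOnto _ hn.symm) (by
      ext x; simp)
  have hFinj : Function.Injective (F ∘ₗ E'.subtype) := by
    refine (injective_iff_map_eq_zero _).2 ?_
    rintro ⟨e, he⟩ h
    have h1 : F e = 0 := h
    have h2 : (u ^ n) e = 0 := by
      obtain ⟨m, rfl⟩ : ∃ m, n = m + 1 := ⟨n - 1, by omega⟩
      rw [pow_succ, Module.End.mul_apply]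
      have : u e = 0 := by simp [u, h1]
      rw [this, map_zero]
    have h3 : e ∈ LinearMap.ker (u ^ n) ⊓ LinearMap.range (u ^ n) := ⟨h2, he⟩
    rw [hn.inf_eq_bot] at h3
    simpa using h3
  refine ⟨LinearMap.range (F ∘ₗ E'.subtype), ?_, 
    Module.Projective.of_equiv (LinearEquiv.ofInjective _ hFinj)⟩
  intro hbot
  obtain ⟨t, ht, ht0⟩ := T.ne_bot_iff.1 hTne
  have h1 : F (ι t) ∈ LinearMap.range (F ∘ₗ E'.subtype) := 
    ⟨⟨ι t, ⟨ι t, hun n t ht⟩⟩, rfl⟩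
  rw [hbot, Submodule.mem_bot] at h1
  have := hinj (a₁ := ⟨t, ht⟩) (a₂ := 0) (by simpa using h1)
  exact ht0 (by simpa using congrArg Subtype.val this)

lemma exists_max_proj (M : Type*) [AddCommGroup M] {S : Type*} [Ring S] [Module S M] :
    ∃ Q : Submodule S M, Module.Projective S Q ∧
      ∀ E : Submodule S M, Module.Projective S E → Disjoint E Q → E = ⊥ := by
  classical
  obtain ⟨s, hs⟩ := zorn_subset
    {s : Set (Submodule S M) | sSupIndep s ∧ ∀ a ∈ s, Module.Projective S a}
    (fun c hc1 hc2 => ⟨⋃₀ c,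
        ⟨iSupIndep_sUnion_of_directed hc2.directedOn fun s hs => (hc1 hs).1,
          fun a ⟨s, sc, as⟩ => (hc1 sc).2 a as⟩,
        fun _ => Set.subset_sUnion_of_mem⟩)
  rw [maximal_subset_iff] at hs
  obtain ⟨⟨s_ind, s_proj⟩, s_max⟩ := hs
  refine ⟨sSup s, ?_, ?_⟩
  · have h := (sSupIndep_iff s).1 s_ind
    have : ∀ a : s, Module.Projective S (a : Submodule S M) := fun a => s_proj a a.2
    refine Module.Projective.of_equiv ((LinearEquiv.ofInjective _ h.dfinsupp_lsum_injective).trans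
      (LinearEquiv.ofEq _ _ ?_))
    rw [← Submodule.iSup_eq_range_dfinsupp_lsum, sSup_eq_iSup']
  · intro E hE hd
    have hmem : E ∈ s := by
      rw [s_max (t := s ∪ {E}) ⟨?_, ?_⟩ Set.subset_union_left]
      · exact Set.mem_union_right _ (Set.mem_singleton _)
      · intro x hx
        rw [Set.mem_union, Set.mem_singleton_iff] at hx
        obtain rfl | xa := eq_or_ne x E
        · simp only [Set.mem_singleton, Set.insert_sdiff_of_mem, Set.union_singleton]
          exact hd.mono_right (sSup_le_sSup Set.sdiff_subset)
        · have h : (s ∪ {E}) \ {x} = s \ {x} ∪ {E} := by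
            simp only [Set.union_singleton]
            rw [Set.insert_sdiff_of_notMem]
            rw [Set.mem_singleton_iff]
            exact Ne.symm xa
          rw [h, sSup_union, sSup_singleton]
          apply
            (s_ind (hx.resolve_right xa)).disjoint_sup_right_of_disjoint_sup_left
              (hd.mono_right _).symm
          rw [← sSup_insert, Set.insert_sdiff_singleton,
            Set.insert_eq_of_mem (hx.resolve_right xa)]
      · intro x hx
        rw [Set.mem_union, Set.mem_singleton_iff] at hx
        obtain hx | rfl := hx
        · exact s_proj x hx
        · exact hE
    exact disjoint_self.1 (hd.mono_right (le_sSup hmem))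

lemma finite_of_soc {S : Type*} [Ring S] [Algebra k S] [Module.Finite k S]
    {M : Type*} [AddCommGroup M] [Module k M] [Module S M] [IsScalarTower k S M]
    (J : Ideal S) (hJ : IsNilpotent J) (V : Submodule k M) (hV : V.FG)
    (h : ∀ m : M, (∀ j ∈ J, j • m = 0) → m ∈ V) : Module.Finite k M := by
  classical
  obtain ⟨t, ht⟩ : (J.restrictScalars k).FG := IsNoetherian.noetherian _
  have htJ : ∀ j ∈ t, j ∈ J := fun j hj => by
    have : j ∈ J.restrictScalars k := ht ▸ Submodule.subset_span hj
    exact this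
  have key : ∀ n : ℕ, ∃ V : Submodule k M, V.FG ∧
      ∀ m : M, (∀ j ∈ J ^ n, j • m = 0) → m ∈ V := by
    intro n
    induction n with
    | zero =>
      refine ⟨⊥, Submodule.fg_bot, fun m hm => ?_⟩
      simpa using hm 1 (by rw [J.pow_zero, Ideal.one_eq_top]; trivial)
    | succ n ih =>
      obtain ⟨V', hV', hm'⟩ := ih
      let D : Submodule k M :=
        { carrier := {m | ∀ j ∈ J ^ (n + 1), j • m = 0}
          zero_mem' := by simp
          add_mem' := fun {a b} ha hb j hj => by rw [smul_add, ha j hj, hb j hj, add_zero]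
          smul_mem' := fun c x hx j hj => by rw [smul_comm, hx j hj, smul_zero] }
      let L : M →ₗ[k] (t → M) := LinearMap.pi (fun j => Module.toModuleEnd k M (j : S))
      refine ⟨D, ?_, fun m hm => hm⟩
      refine Submodule.fg_of_fg_map_of_fg_inf_ker L ?_ ?_
      · have h1 : (Submodule.pi Set.univ (fun _ : t => V')).FG := Submodule.fg_pi (fun _ => hV')
        have : Module.Finite k (Submodule.pi Set.univ (fun _ : t => V')) := Module.Finite.of_fg h1
        refine Submodule.FG.of_le h1 ?_
        rintro _ ⟨m, hm, rfl⟩ j -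
        refine hm' _ (fun y hy => ?_)
        change y • ((j : S) • m) = 0
        rw [smul_smul]
        exact hm _ (by rw [J.pow_succ]; exact Ideal.mul_mem_mul hy (htJ _ j.2))
      · refine Submodule.FG.of_le hV ?_
        rintro m ⟨-, hm⟩
        have hspan : ∀ j ∈ Submodule.span k (t : Set S), j • m = 0 := ?_
        · exact h m (fun j hj => hspan j (by rw [ht]; exact hj))
        intro j hj
        induction hj using Submodule.span_induction with
        | mem x hx => exact congrFun (LinearMap.mem_ker.1 hm) ⟨x, hx⟩
        | zero => simp
        | add x y _ _ hx hy => rw [add_smul, hx, hy, add_zero]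
        | smul c x _ hx => rw [smul_assoc, hx, smul_zero]
  obtain ⟨n, hn⟩ := hJ
  obtain ⟨V', hV', hm⟩ := key n
  have : V' = ⊤ := eq_top_iff.2 fun m _ => hm m (by rw [hn]; simp)
  exact ⟨this ▸ hV'⟩

/-- The radical quotient. -/
abbrev SQ (k : Type*) [Field k] (G : Type*) [Group G] : Type _ :=
  MonoidAlgebra k G ⧸ Ring.jacobson (MonoidAlgebra k G)

lemma exists_decomp (M : Type*) [AddCommGroup M] [Module k M] [Module (MonoidAlgebra k G) M]
    [IsScalarTower k (MonoidAlgebra k G) M] (V W : Submodule k M) (hV : V.FG)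
    (hW : ∀ w ∈ W, ∃ f : SQ k G →ₗ[k] M, 
      (Tr f : SQ k G →ₗ[MonoidAlgebra k G] M) (Submodule.Quotient.mk 1) = w)
    (h : ∀ m : M, (∀ j ∈ Ring.jacobson (MonoidAlgebra k G), j • m = 0) → m ∈ V ⊔ W) :
    ∃ C Q : Submodule (MonoidAlgebra k G) M, IsCompl C Q ∧ 
      Module.Finite (MonoidAlgebra k G) C ∧ Module.Projective (MonoidAlgebra k G) Q := by
  have : Module.Finite k (MonoidAlgebra k G) := inferInstance
  have : IsArtinianRing (MonoidAlgebra k G) := isArtinian_of_tower k inferInstance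
  have : IsSemisimpleModule (MonoidAlgebra k G) (SQ k G) :=
    (IsArtinian.isSemisimpleModule_iff_jacobson _ _).2 (Module.jacobson_quotient_jacobson _ _)
  obtain ⟨Q, hQ, hmax⟩ := exists_max_proj M (S := MonoidAlgebra k G)
  obtain ⟨p, hp⟩ := exists_extend (k := k) hQ Q.subtype Q.subtype_injective LinearMap.id
  have hc : IsCompl (LinearMap.ker p) Q := (LinearMap.isCompl_of_proj hp).symm
  refine ⟨LinearMap.ker p, Q, hc, ?_, hQ⟩
  set C := LinearMap.ker p with hC
  let q : M →ₗ[MonoidAlgebra k G] C := C.projectionOnto Q hc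
  have hq : ∀ c : C, q c = c := fun c => by simp [q]
  have hTr : ∀ (f : SQ k G →ₗ[k] C) x, (Tr f : SQ k G →ₗ[MonoidAlgebra k G] C) x = 0 := by
    intro f x
    by_contra hne
    obtain ⟨E, hE0, hE⟩ := exists_proj_sub f x hne
    have h1 : Module.Projective (MonoidAlgebra k G) (E.map C.subtype) :=
      Module.Projective.of_equiv (Submodule.equivMapOfInjective C.subtype C.subtype_injective E)
    have h2 := hmax _ h1 (hc.disjoint.mono_left (Submodule.map_subtype_le C E))
    exact hE0 (Submodule.map_injective_of_injective C.subtype_injective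
      (by rw [h2, Submodule.map_bot]))
  have : Module.Finite k C := by
    refine finite_of_soc (k := k) (Ring.jacobson (MonoidAlgebra k G))
      IsSemiprimaryRing.isNilpotent (V.map (q.restrictScalars k)) (hV.map _) ?_
    intro c hcj
    have h1 : (c : M) ∈ V ⊔ W := h c (fun j hj => by
      have := congrArg Subtype.val (hcj j hj)
      simpa using this)
    obtain ⟨v, hv, w, hw, hvw⟩ := Submodule.mem_sup.1 h1
    refine ⟨v, hv, ?_⟩
    obtain ⟨f, rfl⟩ := hW w hw
    have h3 := hq c
    rw [← hvw, map_add, comp_Tr, hTr, add_zero] at h3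
    exact h3
  exact Module.Finite.of_restrictScalars_finite k _ _
end gen

section conc
set_option linter.unusedSectionVars false
set_option linter.style.haveILetI false
variable {k A G : Type u} [Field k] [Group A] [Group G] [Fintype G] (φ : G →* MulAut A)

lemma finite_quot_iff {X : Type*} [AddCommGroup X] [Module k X] (B W : Submodule k X) :
    FiniteDimensional k (↥B ⧸ Submodule.comap B.subtype W) ↔
      ∃ V : Submodule k X, V.FG ∧ B ≤ V ⊔ W := by
  constructor
  · intro h
    obtain ⟨s, hs⟩ := (Submodule.comap B.subtype W).mkQ.exists_rightInverse_of_surjective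
      (Submodule.range_mkQ _)
    refine ⟨LinearMap.range (B.subtype ∘ₗ s), Module.Finite.iff_fg.1 inferInstance, ?_⟩
    intro b hb
    refine Submodule.mem_sup.2 ⟨_, ⟨Submodule.Quotient.mk ⟨b, hb⟩, rfl⟩,
      b - s (Submodule.Quotient.mk ⟨b, hb⟩), ?_, ?_⟩
    · have : (⟨b, hb⟩ : B) - s (Submodule.Quotient.mk ⟨b, hb⟩) ∈ Submodule.comap B.subtype W := by
        rw [← Submodule.Quotient.mk_eq_zero, Submodule.Quotient.mk_sub]
        have := LinearMap.congr_fun hs (Submodule.Quotient.mk ⟨b, hb⟩)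
        rw [sub_eq_zero]
        exact this.symm
      exact this
    · simp
  · rintro ⟨V, hV, hB⟩
    let f := Submodule.mapQ (Submodule.comap B.subtype W) W B.subtype le_rfl
    have hf : Function.Injective f := by
      rw [← LinearMap.ker_eq_bot, Submodule.ker_mapQ, eq_bot_iff]
      rintro _ ⟨x, hx, rfl⟩
      simpa using hx
    have hfV : ∀ x, f x ∈ V.map W.mkQ := by
      intro x
      obtain ⟨b, rfl⟩ := Submodule.mkQ_surjective _ x
      obtain ⟨v, hv, w, hw, hvw⟩ := Submodule.mem_sup.1 (hB b.2)
      refine ⟨v, hv, ?_⟩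
      change W.mkQ v = W.mkQ (b : X)
      rw [← hvw, map_add]
      simpa using hw
    have : Module.Finite k (V.map W.mkQ) := Module.Finite.iff_fg.2 (hV.map _)
    exact Module.Finite.of_injective (f.codRestrict _ hfV) (fun x y h => hf (congrArg Subtype.val h))

lemma gAct_single (g : G) (a : A) (c : k) : gAct k φ g (single a c) = single (φ g a) c := by
  simp [gAct]

lemma gAct_mul (g h : G) (r : MonoidAlgebra k A) :
    gAct k φ (g * h) r = gAct k φ g (gAct k φ h r) := by
  induction r using MonoidAlgebra.induction_linear with
  | zero => simp
  | add x y hx hy => simp [hx, hy]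
  | single a c => simp [gAct_single]

lemma gAct_one (r : MonoidAlgebra k A) : gAct k φ 1 r = r := by
  induction r using MonoidAlgebra.induction_linear with
  | zero => simp
  | add x y hx hy => simp [hx, hy]
  | single a c => simp [gAct_single]

lemma orbitSum_apply (r : MonoidAlgebra k A) : orbitSum k φ r = ∑ g : G, gAct k φ g r := by
  simp [orbitSum]

/-- inclusion of kA -/
noncomputable abbrev incA : MonoidAlgebra k A →+* MonoidAlgebra k (A ⋊[φ] G) :=
  MonoidAlgebra.mapDomainRingHom k (SemidirectProduct.inl : A →* A ⋊[φ] G)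
/-- inclusion of kG -/
noncomputable abbrev incG : MonoidAlgebra k G →+* MonoidAlgebra k (A ⋊[φ] G) :=
  MonoidAlgebra.mapDomainRingHom k (SemidirectProduct.inr : G →* A ⋊[φ] G)

lemma incG_mul_incA (g : G) (r : MonoidAlgebra k A) :
    incG φ (single g (1 : k)) * incA φ r = incA φ (gAct k φ g r) * incG φ (single g (1 : k)) := by
  induction r using MonoidAlgebra.induction_linear with
  | zero => simp
  | add x y hx hy => simp only [map_add, mul_add, add_mul, hx, hy]
  | single a c =>
    have : (SemidirectProduct.inr g * SemidirectProduct.inl a : A ⋊[φ] G) =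
        SemidirectProduct.inl (φ g a) * SemidirectProduct.inr g := by
      ext <;> simp
    simp [gAct_single, single_mul_single, this]

lemma incG_mul_incA_of_mem (h : MonoidAlgebra k G) (b : MonoidAlgebra k A) (hb : b ∈ invAlg k φ) :
    incG φ h * incA φ b = incA φ b * incG φ h := by
  induction h using MonoidAlgebra.induction_linear with
  | zero => simp
  | add x y hx hy => simp only [map_add, mul_add, add_mul, hx, hy]
  | single a c =>
    have := incG_mul_incA φ a b
    rw [hb a] at this
    have h1 : (single a c : MonoidAlgebra k G) = c • single a 1 := by simp
    have h2 : incG φ (single a c : MonoidAlgebra k G) = c • incG φ (single a 1) := by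
      simp
    rw [h2, smul_mul_assoc, this, mul_smul_comm]

section mod
variable (M : Type u) [AddCommGroup M] [Module (MonoidAlgebra k (A ⋊[φ] G)) M]

lemma noeth_M (hnoeth : IsNoetherian (invAlg k φ) (MonoidAlgebra k A))
    [Module.Finite (MonoidAlgebra k (A ⋊[φ] G)) M] [Module (invAlg k φ) M]
    (hB : ∀ (b : invAlg k φ) (m : M), b • m = incA φ (b : MonoidAlgebra k A) • m) :
    IsNoetherian (invAlg k φ) M := by
  obtain ⟨n, s, hs⟩ := Module.Finite.exists_fin (R := MonoidAlgebra k (A ⋊[φ] G)) (M := M)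
  let F : Fin n × G → (MonoidAlgebra k A →ₗ[invAlg k φ] M) := fun p =>
    { toFun := fun r => incA φ r • (incG φ (single p.2 (1:k)) • s p.1)
      map_add' := fun x y => by rw [map_add, add_smul]
      map_smul' := fun b x => by
        have h0 : b • x = (b : MonoidAlgebra k A) * x := rfl
        rw [RingHom.id_apply, hB, h0, map_mul, mul_smul] }
  let N : Submodule (invAlg k φ) M := ⨆ p, LinearMap.range (F p)
  have hN : IsNoetherian (invAlg k φ) N := isNoetherian_iSup
  have h1 : ∀ i (x : MonoidAlgebra k (A ⋊[φ] G)), x • s i ∈ N := by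
    intro i x
    induction x using MonoidAlgebra.induction_linear with
    | zero => simp
    | add x y hx hy => rw [add_smul]; exact N.add_mem hx hy
    | single γ c =>
      refine Submodule.mem_iSup_of_mem (i, γ.right) ⟨single γ.left c, ?_⟩
      change incA φ (single γ.left c) • (incG φ (single γ.right (1:k)) • s i) = _
      rw [← mul_smul]
      congr 1
      simp [single_mul_single, SemidirectProduct.ext_iff]
  have h2 : N = ⊤ := by
    rw [eq_top_iff]
    intro m _
    have hm : m ∈ Submodule.span (MonoidAlgebra k (A ⋊[φ] G)) (Set.range s) := by rw [hs]; trivial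
    obtain ⟨c, rfl⟩ := (Submodule.mem_span_range_iff_exists_fun _).1 hm
    exact N.sum_mem (fun i _ => h1 i _)
  rw [h2] at hN
  exact isNoetherian_top_iff.1 hN

lemma soc_fg (hnoeth : IsNoetherian (invAlg k φ) (MonoidAlgebra k A))
    [Module.Finite (MonoidAlgebra k (A ⋊[φ] G)) M] (J : Set (MonoidAlgebra k G)) :
    ∃ (n : ℕ) (y : Fin n → M), (∀ i, ∀ j ∈ J, incG φ j • y i = 0) ∧
      ∀ m : M, (∀ j ∈ J, incG φ j • m = 0) →
        ∃ b : Fin n → invAlg k φ, m = ∑ i, incA φ (b i : MonoidAlgebra k A) • y i := by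
  letI : Module (invAlg k φ) M := Module.compHom M ((incA φ).comp (invAlg k φ).val.toRingHom)
  have hB : ∀ (b : invAlg k φ) (m : M), b • m = incA φ (b : MonoidAlgebra k A) • m :=
    fun _ _ => rfl
  have := noeth_M φ M hnoeth hB
  let D : Submodule (invAlg k φ) M :=
    { carrier := {m | ∀ j ∈ J, incG φ j • m = 0}
      zero_mem' := by simp
      add_mem' := fun {a b} ha hb j hj => by rw [smul_add, ha j hj, hb j hj, add_zero]
      smul_mem' := fun c x hx j hj => by
        rw [hB, ← mul_smul, incG_mul_incA_of_mem φ _ _ c.2, mul_smul, hx j hj, smul_zero] }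
  obtain ⟨n, y, hy⟩ := Submodule.fg_iff_exists_fin_generating_family.1
    (IsNoetherian.noetherian D)
  refine ⟨n, y, fun i => ?_, fun m hm => ?_⟩
  · have : y i ∈ D := hy ▸ Submodule.subset_span ⟨i, rfl⟩
    exact this
  · have : m ∈ D := hm
    rw [← hy] at this
    obtain ⟨c, hc⟩ := (Submodule.mem_span_range_iff_exists_fun _).1 this
    exact ⟨c, hc.symm⟩

lemma backward (hnoeth : IsNoetherian (invAlg k φ) (MonoidAlgebra k A))
    [Module.Finite (MonoidAlgebra k (A ⋊[φ] G)) M] [Module k M]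
    [IsScalarTower k (MonoidAlgebra k (A ⋊[φ] G)) M]
    [Module (MonoidAlgebra k G) M] [IsScalarTower k (MonoidAlgebra k G) M]
    (hG : ∀ (h : MonoidAlgebra k G) (m : M), h • m = incG φ h • m)
    (V0 : Submodule k (MonoidAlgebra k A)) (hV0 : V0.FG)
    (hV : ∀ b ∈ invAlg k φ, b ∈ V0 ⊔ LinearMap.range (orbitSum k φ)) :
    StablyFG (MonoidAlgebra k G) M := by
  obtain ⟨n, y, hy, hgen⟩ := soc_fg φ M hnoeth (Ring.jacobson (MonoidAlgebra k G))
  let W : Submodule k M :=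
    { carrier := {w | ∃ f : SQ k G →ₗ[k] M,
        (Tr f : SQ k G →ₗ[MonoidAlgebra k G] M) (Submodule.Quotient.mk 1) = w}
      zero_mem' := ⟨0, by simp [Tr_apply]⟩
      add_mem' := by
        rintro _ _ ⟨f, rfl⟩ ⟨f', rfl⟩
        exact ⟨f + f', by simp [Tr_apply, Finset.sum_add_distrib]⟩
      smul_mem' := by
        rintro c _ ⟨f, rfl⟩
        refine ⟨c • f, ?_⟩
        simp only [Tr_apply, Finset.smul_sum, LinearMap.smul_apply]
        exact Finset.sum_congr rfl fun g _ => smul_comm _ _ _ }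
  let act : M → (MonoidAlgebra k A →ₗ[k] M) := fun m =>
    { toFun := fun r => incA φ r • m
      map_add' := fun x y => by rw [map_add, add_smul]
      map_smul' := fun c x => by
        have : incA φ (c • x) = c • incA φ x := by simp
        rw [this, smul_assoc]; rfl }
  have hI : ∀ m : M, (∀ j ∈ Ring.jacobson (MonoidAlgebra k G), incG φ j • m = 0) →
      ∀ r, act m (orbitSum k φ r) ∈ W := by
    intro m hm r
    let ρ : SQ k G →ₗ[MonoidAlgebra k G] M :=
      Submodule.liftQ _ (LinearMap.toSpanSingleton (MonoidAlgebra k G) M m) (by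
        intro j hj
        rw [LinearMap.mem_ker, LinearMap.toSpanSingleton_apply, hG]
        exact hm j hj)
    have hρ : ∀ x, ρ (Submodule.Quotient.mk x) = x • m := fun x => rfl
    refine ⟨(Module.toModuleEnd k M (incA φ r)) ∘ₗ (ρ.restrictScalars k), ?_⟩
    rw [Tr_apply]
    change _ = incA φ (orbitSum k φ r) • m
    rw [orbitSum_apply, map_sum, Finset.sum_smul]
    refine Fintype.sum_equiv (Equiv.inv G) _ _ (fun g => ?_)
    change single g⁻¹ (1:k) • (incA φ r • ρ (single g (1:k) • Submodule.Quotient.mk 1)) =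
      incA φ (gAct k φ g⁻¹ r) • m
    rw [map_smul, hρ, one_smul, hG, hG, ← mul_smul, ← mul_smul, incG_mul_incA,
      mul_assoc, ← map_mul, single_mul_single]
    simp [← one_def]
  have hsoc : ∀ m : M, (∀ j ∈ Ring.jacobson (MonoidAlgebra k G), j • m = 0) →
      m ∈ (⨆ i, V0.map (act (y i))) ⊔ W := by
    intro m hm
    obtain ⟨b, rfl⟩ := hgen m (fun j hj => by rw [← hG]; exact hm j hj)
    refine Submodule.sum_mem _ (fun i _ => ?_)
    obtain ⟨v, hv, w, ⟨r, rfl⟩, hvw⟩ := Submodule.mem_sup.1 (hV _ (b i).2)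
    rw [← hvw, map_add, add_smul]
    exact Submodule.add_mem_sup (Submodule.mem_iSup_of_mem i ⟨v, hv, rfl⟩) (hI _ (hy i) r)
  obtain ⟨C, Q, hCQ, hC, hQ⟩ := exists_decomp M (⨆ i, V0.map (act (y i))) W
    (Submodule.fg_iSup _ fun i => hV0.map _) (fun w hw => hw) hsoc
  refine ⟨C, PUnit, Q, inferInstance, inferInstance, inferInstance, inferInstance, inferInstance,
    inferInstance, hC, inferInstance, hQ, ⟨?_⟩⟩
  exact (LinearEquiv.prodUnique).trans (Submodule.prodEquivOfIsCompl C Q hCQ).symm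
end mod

lemma backward' (hnoeth : IsNoetherian (invAlg k φ) (MonoidAlgebra k A))
    (V0 : Submodule k (MonoidAlgebra k A)) (hV0 : V0.FG)
    (hV : ∀ b ∈ invAlg k φ, b ∈ V0 ⊔ LinearMap.range (orbitSum k φ))
    (M : Type u) [AddCommGroup M] [Module (MonoidAlgebra k (A ⋊[φ] G)) M]
    [Module.Finite (MonoidAlgebra k (A ⋊[φ] G)) M] : RestrictedStablyFG k φ M := by
  unfold RestrictedStablyFG
  letI : Module k M := Module.compHom M (algebraMap k (MonoidAlgebra k (A ⋊[φ] G)))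
  have : IsScalarTower k (MonoidAlgebra k (A ⋊[φ] G)) M := 
    IsScalarTower.of_algebraMap_smul fun _ _ => rfl
  letI : Module (MonoidAlgebra k G) M :=
    Module.compHom M
      (MonoidAlgebra.mapDomainRingHom k (SemidirectProduct.inr : G →* A ⋊[φ] G))
  have : IsScalarTower k (MonoidAlgebra k G) M :=
    IsScalarTower.of_algebraMap_smul fun c m => by
      change incG φ (algebraMap k (MonoidAlgebra k G) c) • m = algebraMap k (MonoidAlgebra k (A ⋊[φ] G)) c • m
      congr 1
      simp
  exact backward φ M hnoeth (fun _ _ => rfl) V0 hV0 hV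

lemma inv_of_projective (P : Type u) [AddCommGroup P] [Module (MonoidAlgebra k G) P]
    [hP : Module.Projective (MonoidAlgebra k G) P] (x : P)
    (hx : ∀ g : G, single g (1 : k) • x = x) : ∃ z : P, x = ∑ g : G, single g (1:k) • z := by
  letI : Module k P := Module.compHom P (algebraMap k (MonoidAlgebra k G))
  have : IsScalarTower k (MonoidAlgebra k G) P := 
    IsScalarTower.of_algebraMap_smul fun _ _ => rfl
  obtain ⟨θ, hθ⟩ := exists_theta_of_projective (k := k) hP
  refine ⟨θ x, ?_⟩
  conv_lhs => rw [← hθ x, Tr_apply]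
  refine Fintype.sum_equiv (Equiv.inv G) _ _ (fun g => ?_)
  rw [hx]; rfl

lemma forward_aux {X : Type u} [AddCommGroup X] [Module k X] [Module (MonoidAlgebra k G) X]
    [IsScalarTower k (MonoidAlgebra k G) X] (h : StablyFG (MonoidAlgebra k G) X) :
    ∃ V : Submodule k X, V.FG ∧ ∀ x : X, (∀ g : G, single g (1 : k) • x = x) →
      ∃ v ∈ V, ∃ z : X, x = v + ∑ g : G, single g (1:k) • z := by
  obtain ⟨N, P, Q, _, _, _, _, _, _, hN, hP, hQ, ⟨e⟩⟩ := h
  let T : N × Q →ₗ[MonoidAlgebra k G] X := LinearMap.fst _ X P ∘ₗ e.symm.toLinearMap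
  have hfg : (LinearMap.range (T ∘ₗ LinearMap.inl _ N Q)).FG := 
    Module.Finite.iff_fg.1 inferInstance
  refine ⟨(LinearMap.range (T ∘ₗ LinearMap.inl _ N Q)).restrictScalars k, ?_, ?_⟩
  · have : Module.Finite (MonoidAlgebra k G) (LinearMap.range (T ∘ₗ LinearMap.inl _ N Q)) :=
      inferInstance
    have : Module.Finite k (LinearMap.range (T ∘ₗ LinearMap.inl _ N Q)) :=
      Module.Finite.trans (MonoidAlgebra k G) _
    exact Module.Finite.iff_fg.1 this
  · intro x hx
    have hx2 : ∀ g : G, single g (1 : k) • (e (x, 0)).2 = (e (x, 0)).2 := by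
      intro g
      rw [← Prod.smul_snd, ← map_smul, Prod.smul_mk, hx, smul_zero]
    obtain ⟨z, hz⟩ := inv_of_projective Q _ hx2
    refine ⟨T ((e (x, 0)).1, 0), ⟨(e (x,0)).1, rfl⟩, T (0, z), ?_⟩
    have h1 : x = T (e (x, 0)) := by simp [T]
    have h2 : e (x, 0) = ((e (x, 0)).1, 0) + ∑ g : G, single g (1:k) • ((0 : N), z) := by
      ext
      · simp [Prod.fst_sum]
      · simp [Prod.snd_sum, ← hz]
    conv_lhs => rw [h1, h2, map_add, map_sum]
    simp only [map_smul]

/-- action of Γ on kA -/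
noncomputable def actHom : A ⋊[φ] G →* Module.End k (MonoidAlgebra k A) where
  toFun γ := (LinearMap.mulLeft k (single γ.left (1:k))) ∘ₗ (gAct k φ γ.right).toLinearMap
  map_one' := by
    ext a : 2
    simp [gAct_one, ← one_def]
  map_mul' γ δ := by
    ext a : 2
    simp [gAct_mul, gAct_single, single_mul_single, mul_assoc]

lemma forward (h : ∀ (M : Type u) (_ : AddCommGroup M)
      (_ : Module (MonoidAlgebra k (A ⋊[φ] G)) M),
        Module.Finite (MonoidAlgebra k (A ⋊[φ] G)) M → RestrictedStablyFG k φ M) :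
    ∃ V : Submodule k (MonoidAlgebra k A), V.FG ∧ 
      Subalgebra.toSubmodule (invAlg k φ) ≤ V ⊔ LinearMap.range (orbitSum k φ) := by
  let L := (MonoidAlgebra.lift k (Module.End k (MonoidAlgebra k A)) (A ⋊[φ] G)) (actHom φ)
  letI : Module (MonoidAlgebra k (A ⋊[φ] G)) (MonoidAlgebra k A) :=
    Module.compHom (MonoidAlgebra k A) L.toRingHom
  have hL : ∀ (x : MonoidAlgebra k (A ⋊[φ] G)) (r : MonoidAlgebra k A), x • r = L x r :=
    fun _ _ => rfl
  have hfin : Module.Finite (MonoidAlgebra k (A ⋊[φ] G)) (MonoidAlgebra k A) := by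
    refine ⟨⟨{1}, ?_⟩⟩
    rw [eq_top_iff]
    rintro r -
    rw [Finset.coe_singleton, Submodule.mem_span_singleton]
    refine ⟨incA φ r, ?_⟩
    rw [hL]
    induction r using MonoidAlgebra.induction_linear with
    | zero => simp
    | add x y hx hy => rw [map_add, map_add, LinearMap.add_apply, hx, hy]
    | single a c => simp [L, actHom, MonoidAlgebra.lift_single]
  have h1 := h _ _ _ hfin
  unfold RestrictedStablyFG at h1
  letI : Module (MonoidAlgebra k G) (MonoidAlgebra k A) :=
    Module.compHom (MonoidAlgebra k A)
      (MonoidAlgebra.mapDomainRingHom k (SemidirectProduct.inr : G →* A ⋊[φ] G))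
  have hG : ∀ (x : MonoidAlgebra k G) (r : MonoidAlgebra k A), x • r = L (incG φ x) r :=
    fun _ _ => rfl
  have hGs : ∀ (g : G) (r : MonoidAlgebra k A), single g (1:k) • r = gAct k φ g r := by
    intro g r
    rw [hG]
    simp [L, actHom, MonoidAlgebra.lift_single, ← one_def]
  have : IsScalarTower k (MonoidAlgebra k G) (MonoidAlgebra k A) :=
    IsScalarTower.of_algebraMap_smul fun c m => by
      rw [hG]
      simp [L, MonoidAlgebra.lift_single]
  obtain ⟨V, hV, hb⟩ := forward_aux h1
  refine ⟨V, hV, fun b hbm => ?_⟩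
  obtain ⟨v, hv, z, hz⟩ := hb b (fun g => by rw [hGs]; exact hbm g)
  refine Submodule.mem_sup.2 ⟨v, hv, _, ⟨z, rfl⟩, ?_⟩
  rw [hz, orbitSum_apply]
  simp only [hGs]
end conc

/-- Let k be a field, G a finite group acting by automorphisms on a group A,
Γ = A ⋊ G, so kΓ contains R = kA and H = kG. Let Λ = Σ_{g∈G} g ∈ kG and assume kA is
noetherian as a module over (kA)^G. Then every finitely generated left kΓ-module is stably
finitely generated as a kG-module (under restriction) iff (kA)^G / Λ·kA is
finite-dimensional over k. -/
theorem stmt11 {k A G : Type u} [Field k] [Group A] [Group G] [Fintype G]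
    (φ : G →* MulAut A)
    (hnoeth : IsNoetherian (invAlg k φ) (MonoidAlgebra k A)) :
    (∀ (M : Type u) (_ : AddCommGroup M) (_ : Module (MonoidAlgebra k (A ⋊[φ] G)) M),
        Module.Finite (MonoidAlgebra k (A ⋊[φ] G)) M → RestrictedStablyFG k φ M) ↔
      FiniteDimensional k
        (↥(Subalgebra.toSubmodule (invAlg k φ)) ⧸
          Submodule.comap (Subalgebra.toSubmodule (invAlg k φ)).subtype
            (LinearMap.range (orbitSum k φ))) := by
  rw [finite_quot_iff]
  constructor
  · exact forward φ
  · rintro ⟨V, hV, hB⟩ M _ _ hM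
    exact backward' φ hnoeth V hV (fun b hb => hB hb) M
end

section
/- Let k be a field of characteristic p > 0, let G be a finite p-group acting by automorphisms on a finitely generated torsion-free abelian group A with trivial stabilizers away from the identity (for every a ∈ A with a ≠ 1, only g = 1 fixes a), and let Γ = A ⋊ G. Then every finitely generated left kΓ-module is stably finitely generated as a kG-module under restriction. -/
universe u

theorem aux_exists_fixed {p : ℕ} (hp : p.Prime) {G M : Type*} [Group G] [Finite G]
    (hpG : IsPGroup p G) [AddCommGroup M] [DistribMulAction G M]
    (hpM : ∀ m : M, p • m = 0) (L : AddSubgroup M) (hL : ∀ (g : G), ∀ x ∈ L, g • x ∈ L)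
    (x : M) (hx : x ∈ L) (hx0 : x ≠ 0) : ∃ y ∈ L, y ≠ 0 ∧ ∀ g : G, g • y = y := by
  have : Fact p.Prime := ⟨hp⟩
  let V : AddSubgroup M := AddSubgroup.closure (Set.range fun g : G => g • x)
  have hVL : V ≤ L := by
    rw [AddSubgroup.closure_le]
    rintro _ ⟨g, rfl⟩
    exact hL g x hx
  have hV : ∀ (g : G), ∀ y ∈ V, g • y ∈ V := by
    intro g y hy
    induction hy using AddSubgroup.closure_induction with
    | mem y hy =>
      obtain ⟨h, rfl⟩ := hy
      exact AddSubgroup.subset_closure ⟨g * h, mul_smul g h x⟩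
    | zero => simp
    | add a b _ _ ha hb => rw [smul_add]; exact V.add_mem ha hb
    | neg a _ ha => rw [smul_neg]; exact V.neg_mem ha
  have hxV : x ∈ V := AddSubgroup.subset_closure ⟨1, one_smul G x⟩
  have : AddGroup.FG V := AddGroup.closure_finite_fg _
  have : Finite V := by
    apply AddCommGroup.finite_of_fg_isAddTorsion
    intro v
    rw [isOfFinAddOrder_iff_nsmul_eq_zero]
    exact ⟨p, hp.pos, Subtype.ext (hpM v)⟩
  let : MulAction G V :=
    { smul := fun g v => ⟨g • v.1, hV g v.1 v.2⟩
      one_smul := fun v => Subtype.ext (one_smul G v.1)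
      mul_smul := fun g h v => Subtype.ext (mul_smul g h v.1) }
  have hcard : p ∣ Nat.card V := by
    have h1 : addOrderOf (⟨x, hxV⟩ : V) = p :=
      addOrderOf_eq_prime (Subtype.ext (hpM x)) (fun h => hx0 (congrArg Subtype.val h))
    rw [← h1]
    exact addOrderOf_dvd_natCard _
  obtain ⟨b, hb, hb0⟩ := hpG.exists_fixed_point_of_prime_dvd_card_of_fixed_point V hcard
    (a := 0) (fun g => Subtype.ext (smul_zero g))
  refine ⟨b.1, hVL b.2, fun h => hb0 (Subtype.ext h.symm), fun g => ?_⟩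
  exact congrArg Subtype.val (hb g)

open MonoidAlgebra in
theorem aux_exists_fixed' {k : Type*} {p : ℕ} [Field k] (hp : p.Prime) [CharP k p]
    {G M : Type*} [Group G] [Fintype G] (hpG : IsPGroup p G)
    [AddCommGroup M] [Module k M] [Module (MonoidAlgebra k G) M]
    (L : AddSubgroup M) (hL : ∀ (g : G), ∀ x ∈ L, (single g (1 : k) : MonoidAlgebra k G) • x ∈ L)
    (h0 : ∀ y ∈ L, (∀ g : G, (single g (1 : k) : MonoidAlgebra k G) • y = y) → y = 0) :
    ∀ x ∈ L, x = 0 := by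
  intro x hx
  by_contra hx0
  let : DistribMulAction G M := DistribMulAction.compHom M (MonoidAlgebra.of k G)
  obtain ⟨y, hy, hy0, hyg⟩ := aux_exists_fixed (M := M) hp hpG (fun m => by
    rw [← Nat.cast_smul_eq_nsmul k, CharP.cast_eq_zero, zero_smul]) L hL x hx hx0
  exact hy0 (h0 y hy hyg)

open MonoidAlgebra in
theorem aux_finite {k : Type*} {p : ℕ} [Field k] (hp : p.Prime) [CharP k p]
    {G M' : Type*} [Group G] [Fintype G] (hpG : IsPGroup p G)
    [AddCommGroup M'] [Module k M'] [Module k[G] M'] [IsScalarTower k k[G] M']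
    (U : Submodule k M') (hU : ∀ x : M', (∀ g : G, (single g (1 : k) : k[G]) • x = x) → x ∈ U)
    (hUfd : FiniteDimensional k U) : FiniteDimensional k M' := by
  let ι : U →ₗ[k] M' := U.subtype
  have hι : LinearMap.ker ι = ⊥ := U.ker_subtype
  obtain ⟨q, hq⟩ := LinearMap.exists_leftInverse_of_injective ι hι
  let j : M' →ₗ[k] (G → U) := LinearMap.pi fun g =>
    q ∘ₗ (Algebra.lsmul k k M' (single g (1 : k) : k[G]))
  have hj : ∀ x g, j x g = q ((single g (1 : k) : k[G]) • x) := fun x g => rfl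
  have hj0 : ∀ y ∈ j.toAddMonoidHom.ker, y = 0 := by
    apply aux_exists_fixed' (k := k) hp hpG
    · intro g x hx
      have hx : j x = 0 := hx
      change j _ = 0
      ext1 h
      rw [hj, ← mul_smul, MonoidAlgebra.single_mul_single, mul_one, ← hj, hx]
      rfl
    · intro y hy hyg
      have hy : j y = 0 := hy
      have h1 : q y = (⟨y, hU y hyg⟩ : U) := LinearMap.congr_fun hq (⟨y, hU y hyg⟩ : U)
      have h2 := hj y 1
      rw [hy, hyg 1, h1] at h2
      exact (congrArg Subtype.val h2).symm
  have hM'fd : FiniteDimensional k M' :=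
    FiniteDimensional.of_injective j ((injective_iff_map_eq_zero j).2 hj0)
  exact hM'fd

open MonoidAlgebra in
theorem aux_stablyFG {k : Type u} {p : ℕ} [Field k] (hp : p.Prime) [CharP k p]
    {G : Type u} [Group G] [Fintype G] (hpG : IsPGroup p G)
    (M : Type u) [AddCommGroup M] [Module k M] [Module (MonoidAlgebra k G) M]
    [IsScalarTower k (MonoidAlgebra k G) M]
    (W : Submodule k M) (hW : W.FG)
    (hfin : ∀ m : M, (∀ g : G, (single g (1 : k) : MonoidAlgebra k G) • m = m) →
      ∃ m' : M, ∃ w ∈ W, m = (∑ g : G, (single g (1 : k) : MonoidAlgebra k G)) • m' + w) :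
    StablyFG (MonoidAlgebra k G) M := by
  let N : k[G] := ∑ g : G, single g (1 : k)
  have hNc : ∀ g, N.coeff g = 1 := by
    intro g
    simp [N, MonoidAlgebra.coeff_sum, Finsupp.finsetSum_apply]
  let n : M →ₗ[k] M := Algebra.lsmul k k M N
  have hn : ∀ m, n m = N • m := fun m => rfl
  let b := Module.Basis.ofVectorSpace k (LinearMap.range n)
  let I := Module.Basis.ofVectorSpaceIndex k (LinearMap.range n)
  have hb : ∀ i : I, ∃ m : M, N • m = (b i : M) := fun i => (b i).2
  choose m hm using hb
  let f : (I →₀ k[G]) →ₗ[k[G]] M := Finsupp.linearCombination k[G] m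
  let c1 : k[G] →ₗ[k] k :=
    Finsupp.lapply (1 : G) ∘ₗ (MonoidAlgebra.coeffLinearEquiv k).toLinearMap
  let π1 : (I →₀ k[G]) →ₗ[k] (I →₀ k) := Finsupp.mapRange.linearMap c1
  have hπ1 : ∀ (x : I →₀ k[G]) i, π1 x i = (x i).coeff 1 := fun x i => rfl
  have hsm : ∀ (g h : G) (x : k[G]), (single g (1 : k) * x).coeff h = x.coeff (g⁻¹ * h) := by
    intro g h x
    simp [MonoidAlgebra.coeff_single_mul_apply]
  -- injectivity
  have hf0 : ∀ y ∈ f.toAddMonoidHom.ker, y = 0 := by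
    apply aux_exists_fixed' (k := k) hp hpG
    · intro g x hx
      have hx : f x = 0 := hx
      change f _ = 0
      rw [map_smul, hx, smul_zero]
    · intro y hy hyg
      have hy : f y = 0 := hy
      have h1 : ∀ i, y i = (π1 y i) • N := by
        intro i
        ext g
        have := hyg g
        have h2 : ((single g (1 : k) : k[G]) * y i).coeff g = (y i).coeff g := by
          conv_rhs => rw [← this]
          rfl
        rw [hsm, inv_mul_cancel] at h2
        rw [hπ1, ← h2]
        simp [hNc]
      have h2 : f y = (Finsupp.linearCombination k b (π1 y) : LinearMap.range n) := by
        change Finsupp.linearCombination k[G] m y =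
          (Finsupp.linearCombination k b (Finsupp.mapRange c1 (map_zero c1) y) : LinearMap.range n)
        rw [Finsupp.linearCombination_apply, Finsupp.linearCombination_apply,
          Finsupp.sum_mapRange_index (by simp)]
        simp only [Finsupp.sum, Submodule.coe_sum, Submodule.coe_smul, ← hm]
        refine Finset.sum_congr rfl fun i _ => ?_
        rw [← smul_assoc]
        exact congrArg (· • m i) (h1 i)
      have h3 : π1 y = 0 := by
        rw [hy] at h2
        exact (linearIndependent_iff.1 b.linearIndependent) _ (Subtype.ext h2.symm)
      ext1 i
      rw [h1, h3]
      simp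
  have hfinj : Function.Injective f := (injective_iff_map_eq_zero f).2 hf0
  -- the retraction
  obtain ⟨l, hl⟩ := LinearMap.exists_leftInverse_of_injective (f.restrictScalars k)
    (LinearMap.ker_eq_bot.2 hfinj)
  have hl : ∀ x, l (f x) = x := fun x => LinearMap.congr_fun hl x
  let r : M →ₗ[k] (I →₀ k) := π1 ∘ₗ l
  let ρ0 : M →ₗ[k] (I →₀ k[G]) := ∑ g : G,
    Finsupp.mapRange.linearMap (MonoidAlgebra.lsingle g) ∘ₗ r ∘ₗ
      (Algebra.lsmul k k M (single g⁻¹ (1 : k) : k[G]))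
  have hρ0 : ∀ x i g, (ρ0 x i).coeff g = r ((single g⁻¹ (1 : k) : k[G]) • x) i := by
    intro x i g
    classical
    simp [ρ0, LinearMap.sum_apply, Finsupp.finsetSum_apply, MonoidAlgebra.coeff_sum,
      Finsupp.single_apply]
  let ρ : M →ₗ[k[G]] (I →₀ k[G]) := MonoidAlgebra.equivariantOfLinearOfComm ρ0 (by
    intro g v
    ext i h
    rw [hρ0, Finsupp.smul_apply, smul_eq_mul, hsm, hρ0, ← mul_smul]
    simp)
  have hρ : ∀ x i g, (ρ x i).coeff g = r ((single g⁻¹ (1 : k) : k[G]) • x) i := hρ0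
  have hρf : ∀ x, ρ (f x) = x := by
    intro x
    ext i g
    rw [hρ, ← map_smul]
    change π1 (l (f _)) i = _
    rw [hl, hπ1, Finsupp.smul_apply, smul_eq_mul, hsm]
    simp
  let M' := LinearMap.ker ρ
  let π : M →ₗ[k[G]] M' := LinearMap.codRestrict M' (LinearMap.id - f ∘ₗ ρ) (by
    intro x
    simp [M', hρf])
  have hπ : ∀ x, (π x : M) = x - f (ρ x) := fun x => rfl
  have hπM : ∀ x : M', π x = x := by
    intro x
    apply Subtype.ext
    rw [hπ, LinearMap.mem_ker.1 x.2]
    simp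
  let e : (M × PUnit.{u+1}) ≃ₗ[k[G]] (M' × (I →₀ k[G])) :=
    { toFun := fun x => (π x.1, ρ x.1)
      invFun := fun y => (y.1 + f y.2, 0)
      map_add' := fun x y => by simp
      map_smul' := fun c x => by simp
      left_inv := fun x => by
        refine Prod.ext ?_ rfl
        simp [hπ]
      right_inv := fun y => by
        have h1 : ρ (y.1 + f y.2) = y.2 := by
          rw [map_add, hρf, LinearMap.mem_ker.1 y.1.2, zero_add]
        refine Prod.ext (Subtype.ext ?_) h1
        change ((π (y.1 + f y.2) : M') : M) = _
        rw [hπ, h1]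
        simp }
  -- finiteness
  let U : Submodule k M' :=
    { carrier := {x | ∀ g : G, (single g (1 : k) : k[G]) • x = x}
      add_mem' := fun {a b} ha hb g => by rw [smul_add, ha g, hb g]
      zero_mem' := fun g => smul_zero _
      smul_mem' := fun c x hx g => by rw [smul_comm, hx g] }
  have hUW : U ≤ W.map (π.restrictScalars k) := by
    intro x hx
    have hx : ∀ g : G, (single g (1 : k) : k[G]) • x = x := hx
    obtain ⟨m', w, hw, h⟩ := hfin x (fun g => congrArg Subtype.val (hx g))
    refine ⟨w, hw, ?_⟩
    change π w = x
    have h0 : π (N • m') = 0 := by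
      have h1 : N • m' ∈ LinearMap.range f := by
        have h2 : ((⟨n m', LinearMap.mem_range_self n m'⟩ : LinearMap.range n)) ∈
          Submodule.span k (Set.range b) := by rw [b.span_eq]; trivial
        have h3 := Submodule.mem_map_of_mem (f := (LinearMap.range n).subtype) h2
        rw [Submodule.map_span] at h3
        have h4 : Submodule.span k ((LinearMap.range n).subtype '' Set.range b) ≤
            (LinearMap.range f).restrictScalars k := by
          rw [Submodule.span_le]
          rintro _ ⟨_, ⟨i, rfl⟩, rfl⟩
          refine ⟨Finsupp.single i N, ?_⟩
          change Finsupp.linearCombination k[G] m _ = _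
          rw [Finsupp.linearCombination_single]
          exact hm i
        exact h4 h3
      obtain ⟨y, hy⟩ := h1
      apply Subtype.ext
      rw [← hy, hπ, hρf]
      simp
    rw [← hπM x, h, map_add]
    change _ = π (N • m') + _
    rw [h0, zero_add]
  have hWfd : FiniteDimensional k (W.map (π.restrictScalars k)) :=
    Module.Finite.iff_fg.2 (hW.map _)
  have hUfd : FiniteDimensional k U := Submodule.finiteDimensional_of_le hUW
  have hM'fd : FiniteDimensional k M' := aux_finite hp hpG U (fun x hx => hx) hUfd
  refine ⟨M', PUnit.{u+1}, I →₀ k[G], inferInstance, inferInstance, inferInstance, inferInstance,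
    inferInstance, inferInstance, ?_, inferInstance, inferInstance, ⟨e⟩⟩
  exact Module.Finite.of_restrictScalars_finite k k[G] M'

theorem aux_noeth {k S G : Type*} [Field k] [CommRing S] [Algebra k S] [Algebra.FiniteType k S]
    [Group G] [Finite G] (ψ : G →* (S ≃ₐ[k] S)) (R : Subalgebra k S)
    (hR : ∀ s, s ∈ R ↔ ∀ g, ψ g s = s) : IsNoetherianRing R ∧ Module.Finite R S := by
  let : MulSemiringAction G S := MulSemiringAction.compHom S ψ
  have hinv : Algebra.IsInvariant R S G := ⟨fun b hb => ⟨⟨b, (hR b).2 hb⟩, rfl⟩⟩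
  have hint : Algebra.IsIntegral R S := Algebra.IsInvariant.isIntegral R S G
  have hft : Algebra.FiniteType R S := Algebra.FiniteType.of_restrictScalars_finiteType k R S
  have hfin : Module.Finite R S := Algebra.IsIntegral.finite
  have h := fg_of_fg_of_fg k R S Algebra.FiniteType.out Module.Finite.fg_top
    Subtype.val_injective
  have : Algebra.FiniteType k R := ⟨h⟩
  exact ⟨Algebra.FiniteType.isNoetherianRing k R, hfin⟩

open MonoidAlgebra in
theorem aux_coeff {k A G : Type*} [Field k] [CommGroup A] [Group G]
    (φ : G →* MulAut A) (g : G) (s : k[A]) (a : A) :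
    (domCongrAut (R := k) (A := k) (φ g) s).coeff a = s.coeff (φ g⁻¹ a) := by
  obtain ⟨b, rfl⟩ := (φ g).surjective a
  have h : φ g⁻¹ (φ g b) = b := by
    rw [← MulAut.mul_apply, ← map_mul]; simp
  rw [h]
  simp [domCongrAut]

open MonoidAlgebra in
theorem aux_trace {k A G : Type*} [Field k] [CommGroup A] [Group G] [Fintype G]
    (φ : G →* MulAut A) (hfree : ∀ a : A, a ≠ 1 → ∀ g : G, φ g a = a → g = 1)
    (r : k[A]) (hr : ∀ g, domCongrAut (R := k) (A := k) (φ g) r = r) :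
    ∃ (c : k) (s : k[A]), r = single 1 c + ∑ g : G, domCongrAut (R := k) (A := k) (φ g) s := by
  classical
  let : MulAction G A := MulAction.compHom A φ
  have hsm : ∀ (g : G) (a : A), g • a = φ g a := fun _ _ => rfl
  let rep : A → A := fun a => (Quotient.mk (MulAction.orbitRel G A) a).out
  have hrep1 : ∀ (g : G) a, rep (φ g a) = rep a := by
    intro g a
    have : Quotient.mk (MulAction.orbitRel G A) (φ g a) = Quotient.mk (MulAction.orbitRel G A) a :=
      Quotient.sound ⟨g, rfl⟩
    simp only [rep, this]
  have hrep2 : ∀ a, ∃ g : G, φ g a = rep a := by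
    intro a
    exact Quotient.mk_out (s := MulAction.orbitRel G A) a
  have hrc : ∀ (g : G) a, r.coeff (φ g a) = r.coeff a := by
    intro g a
    have := aux_coeff φ g⁻¹ r a
    rw [hr, inv_inv] at this
    exact this.symm
  have hg1 : ∀ (g : G) a, φ g a = 1 → a = 1 := fun g a h =>
    (φ g).injective (h.trans (map_one _).symm)
  let s : k[A] := MonoidAlgebra.ofCoeff (r.coeff.filter fun a => a ≠ 1 ∧ rep a = a)
  have hs : ∀ a, s.coeff a = if a ≠ 1 ∧ rep a = a then r.coeff a else 0 := fun a =>
    Finsupp.filter_apply _ _ _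
  refine ⟨r.coeff 1, s, ?_⟩
  ext a
  rw [MonoidAlgebra.coeff_add, MonoidAlgebra.coeff_sum, Finsupp.add_apply,
    Finsupp.finsetSum_apply]
  simp only [aux_coeff, hs]
  by_cases ha : a = 1
  · subst ha
    simp
  · obtain ⟨g0, hg0⟩ := hrep2 a
    rw [Finset.sum_eq_single g0⁻¹]
    · rw [if_pos]
      · rw [hrc]
        simp [Finsupp.single_apply, Ne.symm ha]
      · refine ⟨fun h => ha (hg1 _ _ h), ?_⟩
        rw [hrep1, inv_inv, hg0]
    · intro g _ hg
      rw [if_neg]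
      rintro ⟨-, h⟩
      apply hg
      rw [hrep1, ← hg0] at h
      have : φ (g * g0) a = a := by
        rw [map_mul, MulAut.mul_apply, h, ← MulAut.mul_apply, ← map_mul]; simp
      exact eq_inv_of_mul_eq_one_left (hfree a ha _ this)
    · simp

open MonoidAlgebra in
theorem aux_finite_restrict {k A G : Type*} [Field k] [CommGroup A] [Group G] [Finite G]
    (φ : G →* MulAut A) (M : Type*) [AddCommGroup M] [Module k[A ⋊[φ] G] M]
    (hM : Module.Finite k[A ⋊[φ] G] M) :
    letI : Module k[A] M := Module.compHom M
      (mapDomainRingHom k (SemidirectProduct.inl : A →* A ⋊[φ] G))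
    Module.Finite k[A] M := by
  let iA := mapDomainRingHom k (SemidirectProduct.inl : A →* A ⋊[φ] G)
  let : Module k[A] M := Module.compHom M iA
  let : Module k[A] k[A ⋊[φ] G] := Module.compHom k[A ⋊[φ] G] iA
  have : IsScalarTower k[A] k[A ⋊[φ] G] M := ⟨fun x y z => mul_smul (iA x) y z⟩
  have : Module.Finite k[A] k[A ⋊[φ] G] := by
    refine ⟨Submodule.fg_def.2 ⟨Set.range fun g : G => single (SemidirectProduct.inr g) (1 : k),
      Set.finite_range _, ?_⟩⟩
    rw [eq_top_iff]
    rintro x -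
    induction x using MonoidAlgebra.induction_linear with
    | zero => exact Submodule.zero_mem _
    | add f g hf hg => exact Submodule.add_mem _ hf hg
    | single a c =>
      have : single a c = (single a.left c : k[A]) •
          (single (SemidirectProduct.inr a.right) (1 : k) : k[A ⋊[φ] G]) := by
        change _ = iA (single a.left c) * _
        simp [iA]
      rw [this]
      exact Submodule.smul_mem _ _ (Submodule.subset_span ⟨_, rfl⟩)
  exact Module.Finite.trans k[A ⋊[φ] G] M

open MonoidAlgebra in
theorem aux_comm {k A G : Type*} [Field k] [CommGroup A] [Group G]
    (φ : G →* MulAut A) (g : G) (s : k[A]) :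
    (single (SemidirectProduct.inr g) (1 : k) : k[A ⋊[φ] G]) *
      mapDomainRingHom k (SemidirectProduct.inl : A →* A ⋊[φ] G) s =
    mapDomainRingHom k (SemidirectProduct.inl : A →* A ⋊[φ] G)
      (domCongrAut (R := k) (A := k) (φ g) s) * single (SemidirectProduct.inr g) (1 : k) := by
  induction s using MonoidAlgebra.induction_linear with
  | zero => simp
  | add f g hf hg => simp only [map_add, mul_add, add_mul, hf, hg]
  | single a c =>
    simp [SemidirectProduct.inl_aut]

open MonoidAlgebra in
theorem aux_main {k A G : Type*} [Field k] [CommGroup A] [Group.FG A] [Group G] [Fintype G]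
    (φ : G →* MulAut A) (hfree : ∀ a : A, a ≠ 1 → ∀ g : G, φ g a = a → g = 1)
    (M : Type*) [AddCommGroup M] [Module k[A ⋊[φ] G] M]
    (hM : Module.Finite k[A ⋊[φ] G] M) :
    ∃ t : Finset M, ∀ m : M,
      (∀ g : G, (single (SemidirectProduct.inr g) (1 : k) : k[A ⋊[φ] G]) • m = m) →
      ∃ (m' : M) (c : M → k),
        m = (∑ g : G, (single (SemidirectProduct.inr g) (1 : k) : k[A ⋊[φ] G])) • m' +
          ∑ x ∈ t, (single 1 (c x) : k[A ⋊[φ] G]) • x := by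
  let iA := mapDomainRingHom k (SemidirectProduct.inl : A →* A ⋊[φ] G)
  let ψ : G →* (k[A] ≃ₐ[k] k[A]) := (domCongrAut (R := k) (A := k)).comp φ
  let : Module k[A] M := Module.compHom M iA
  have hsm : ∀ (s : k[A]) (m : M), s • m = iA s • m := fun _ _ => rfl
  have hMA : Module.Finite k[A] M := aux_finite_restrict φ M hM
  let R : Subalgebra k k[A] :=
    { carrier := {s | ∀ g, ψ g s = s}
      mul_mem' := fun {a b} ha hb g => by rw [map_mul, ha g, hb g]
      add_mem' := fun {a b} ha hb g => by rw [map_add, ha g, hb g]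
      algebraMap_mem' := fun c g => AlgEquiv.commutes _ c }
  obtain ⟨hN, hF⟩ := aux_noeth ψ R (fun s => Iff.rfl)
  have hMR : Module.Finite R M := Module.Finite.trans k[A] M
  have hcomm : ∀ (g : G) (s : k[A]) (m : M),
      (single (SemidirectProduct.inr g) (1 : k) : k[A ⋊[φ] G]) • (s • m) =
        ψ g s • ((single (SemidirectProduct.inr g) (1 : k) : k[A ⋊[φ] G]) • m) := by
    intro g s m
    rw [hsm, hsm, ← mul_smul, ← mul_smul]
    exact congrArg (· • m) (aux_comm φ g s)
  let F : Submodule R M :=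
    { carrier := {m | ∀ g : G, (single (SemidirectProduct.inr g) (1 : k) : k[A ⋊[φ] G]) • m = m}
      add_mem' := fun {a b} ha hb g => by rw [smul_add, ha g, hb g]
      zero_mem' := fun g => smul_zero _
      smul_mem' := fun r x hx g => by
        change _ • (r.1 • x) = r.1 • x
        rw [hcomm, r.2 g, hx g] }
  have hFfg : F.FG := IsNoetherian.noetherian F
  obtain ⟨t, ht⟩ := hFfg
  have htF : ∀ x ∈ t, x ∈ F := fun x hx => ht ▸ Submodule.subset_span hx
  refine ⟨t, fun m hm => ?_⟩
  have hmF : m ∈ Submodule.span R (t : Set M) := by rw [ht]; exact hm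
  obtain ⟨f, -, hf⟩ := Submodule.mem_span_finset.1 hmF
  have hdec : ∀ r : R, ∃ (c : k) (s : k[A]), r.1 = single 1 c + ∑ g : G, ψ g s := fun r =>
    aux_trace φ hfree r.1 r.2
  choose c s hcs using hdec
  refine ⟨∑ x ∈ t, s (f x) • x, fun x => c (f x), ?_⟩
  rw [← hf, Finset.smul_sum, ← Finset.sum_add_distrib]
  refine Finset.sum_congr rfl fun x hx => ?_
  change (f x).1 • x = _
  rw [hcs, add_smul, add_comm, Finset.sum_smul, Finset.sum_smul]
  congr 1
  · refine Finset.sum_congr rfl fun g _ => ?_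
    rw [hcomm, htF x hx g]
  · rw [hsm]
    simp [iA]

/-- Let k be a field of characteristic p > 0, G a finite p-group acting by
automorphisms on a finitely generated torsion-free abelian group A with trivial stabilizers
away from the identity, and Γ = A ⋊ G. Then every finitely generated left kΓ-module is
stably finitely generated as a kG-module under restriction. -/
theorem stmt13 {k : Type u} {p : ℕ} [Field k] (hp : p.Prime) [CharP k p]
    {A G : Type u} [CommGroup A] [Group.FG A]
    (htf : ∀ a : A, a ≠ 1 → ¬IsOfFinOrder a)
    [Group G] [Fintype G] (hpG : IsPGroup p G)
    (φ : G →* MulAut A)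
    (hfree : ∀ a : A, a ≠ 1 → ∀ g : G, φ g a = a → g = 1) :
    ∀ (M : Type u) (_ : AddCommGroup M) (_ : Module (MonoidAlgebra k (A ⋊[φ] G)) M),
      Module.Finite (MonoidAlgebra k (A ⋊[φ] G)) M → RestrictedStablyFG k φ M := by
  intro M _ _ hM
  obtain ⟨t, ht⟩ := aux_main φ hfree M hM
  let : Module k M := Module.compHom M (algebraMap k (MonoidAlgebra k (A ⋊[φ] G)))
  let : Module (MonoidAlgebra k G) M := Module.compHom M
      (MonoidAlgebra.mapDomainRingHom k (SemidirectProduct.inr : G →* A ⋊[φ] G))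
  have hk : ∀ (c : k) (m : M), c • m =
    (MonoidAlgebra.single 1 c : MonoidAlgebra k (A ⋊[φ] G)) • m := fun _ _ => rfl
  have hG : ∀ (x : MonoidAlgebra k G) (m : M), x • m =
    (MonoidAlgebra.mapDomainRingHom k (SemidirectProduct.inr : G →* A ⋊[φ] G) x) • m :=
    fun _ _ => rfl
  have : IsScalarTower k (MonoidAlgebra k G) M := by
    refine ⟨fun c x m => ?_⟩
    rw [hk, hG, hG, ← mul_smul, Algebra.smul_def, map_mul]
    congr 2
    simp
  refine aux_stablyFG hp hpG M (Submodule.span k (t : Set M)) ⟨t, rfl⟩ ?_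
  intro m hm
  obtain ⟨m', c, h⟩ := ht m (fun g => by simpa [hG] using hm g)
  refine ⟨m', ∑ x ∈ t, c x • x, Submodule.sum_mem _ fun x hx =>
    Submodule.smul_mem _ _ (Submodule.subset_span hx), ?_⟩
  rw [hG, map_sum]
  simpa [hk] using h
end
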